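/- For every ε > 0 and every prime p, at least one of the following holds: (1) the least quadratic nonresidue n_p modulo p satisfies n_p ≤ C(ε)*p^{1/(6√e)+ε}, or (2) for every c coprime to p and every H with C(ε)*p^{1/6+ε} ≤ H < p, there exist X, Y ∈ {0,...,p-1} such that the box B(X,Y;H) contains at least two points of the modular hyperbola x*y ≡ c (mod p). -/

import Mathlib

/-- `x` lies (as a residue mod `p`) in the interval `[X+1, X+H]` taken mod `p`. -/
def InBox (p : ℕ) (X H : ℤ) (x : ZMod p) : Prop :=
  ∃ t : ℤ, X + 1 ≤ t ∧ t ≤ X + H ∧ (t : ZMod p) = x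

section
open Polynomial

namespace Stp
variable {p : ℕ} [Fact p.Prime]

/-- twisted derivative operator -/
noncomputable def D (f : (ZMod p)[X]) (m : ZMod p) : ℕ → ((ZMod p)[X] →ₗ[ZMod p] (ZMod p)[X])
  | 0 => LinearMap.id
  | k+1 => (LinearMap.mulLeft (ZMod p) f ∘ₗ derivative +
      LinearMap.mulLeft (ZMod p) (C (m - k) * derivative f)) ∘ₗ D f m k

lemma D_succ (f : (ZMod p)[X]) (m : ZMod p) (k : ℕ) (r : (ZMod p)[X]) :
    D f m (k+1) r = f * derivative (D f m k r) + C (m - k) * derivative f * D f m k r := rfl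

lemma D_spec (f : (ZMod p)[X]) (n k : ℕ) (hk : k ≤ n) (r : (ZMod p)[X]) :
    derivative^[k] (f ^ n * r) = f ^ (n - k) * D f (n : ZMod p) k r := by
  induction k with
  | zero => simp [D]
  | succ k ih =>
    rw [Function.iterate_succ_apply', ih (by omega), D_succ]
    obtain ⟨e, he⟩ : ∃ e, n = k + 1 + e := ⟨n - (k+1), by omega⟩
    have h1 : n - k = e + 1 := by omega
    have h2 : n - (k+1) = e := by omega
    rw [h1, h2, derivative_mul, derivative_pow]
    have h3 : ((n : ZMod p) - k) = ((e + 1 : ℕ) : ZMod p) := by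
      rw [he]; push_cast; ring
    rw [h3]
    simp only [Nat.add_sub_cancel]
    ring

lemma D_deg (f : (ZMod p)[X]) (d : ℕ) (hd : f.natDegree ≤ d) (m : ZMod p) (k : ℕ) (r : (ZMod p)[X]) :
    (D f m k r).natDegree ≤ r.natDegree + k * d := by
  induction k with
  | zero => simp [D]
  | succ k ih =>
    rw [D_succ]
    refine (natDegree_add_le _ _).trans (max_le ?_ ?_)
    · refine natDegree_mul_le.trans ?_
      have := natDegree_derivative_le (D f m k r)
      have e : (k+1) * d = k * d + d := by ring
      omega
    · refine natDegree_mul_le.trans ?_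
      have h1 : (C (m - k) * derivative f).natDegree ≤ d := by
        refine (natDegree_C_mul_le _ _).trans ?_
        have := natDegree_derivative_le f
        omega
      have e : (k+1) * d = k * d + d := by ring
      omega

lemma deriv_X (j k : ℕ) (w : (ZMod p)[X]) :
    derivative^[k] (X ^ (p * j) * w) = X ^ (p * j) * derivative^[k] w := by
  induction k with
  | zero => simp
  | succ k ih =>
    rw [Function.iterate_succ_apply', ih, Function.iterate_succ_apply', derivative_mul]
    have : derivative ((X : (ZMod p)[X]) ^ (p * j)) = 0 := by
      rw [derivative_X_pow]; simp
    rw [this]; simp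

lemma parity (f r s : (ZMod p)[X]) (κ : ZMod p) (hκ : κ ≠ 0) (z : ZMod p)
    (hodd : Odd (f.rootMultiplicity z)) (h : r ^ 2 * f = C κ * s ^ 2) : r = 0 ∧ s = 0 := by
  have hf : f ≠ 0 := by
    rintro rfl
    simp at hodd
  have hr : r = 0 := by
    by_contra hr
    have hs : s ≠ 0 := by
      rintro rfl
      simp [hr, hf] at h
    have h1 := congrArg (rootMultiplicity z) h
    have hC : C κ ≠ 0 := by simpa using hκ
    rw [rootMultiplicity_mul (mul_ne_zero (pow_ne_zero _ hr) hf),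
      rootMultiplicity_mul (mul_ne_zero hC (pow_ne_zero _ hs)), rootMultiplicity_C] at h1
    simp only [pow_two] at h1
    rw [rootMultiplicity_mul (mul_ne_zero hr hr), rootMultiplicity_mul (mul_ne_zero hs hs)] at h1
    obtain ⟨t, ht⟩ := hodd
    omega
  refine ⟨hr, ?_⟩
  subst hr
  simp at h
  rcases h with h | h
  · exact absurd h hκ
  · exact h

lemma key_dvd (hp2 : p ≠ 2) (f r s : (ZMod p)[X]) (c d : ℕ) (hd : f.natDegree ≤ d) (hc : 2 * c + d ≤ p) (hc0 : 0 < c)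
    (hr : r.natDegree < c) (hs : s.natDegree < c) (h0 : f.eval 0 ≠ 0) (z : ZMod p)
    (hodd : Odd (f.rootMultiplicity z)) (h : X ^ p ∣ r + s * f ^ (p / 2)) : r = 0 ∧ s = 0 := by
  have hpo : 2 * (p/2) + 1 = p := by
    have := (Fact.out : p.Prime).eq_two_or_odd
    omega
  have h1 : X ^ p ∣ r ^ 2 * f - s ^ 2 * f ^ p := by
    have : r ^ 2 * f - s ^ 2 * f ^ p = (r + s * f ^ (p / 2)) * ((r - s * f ^ (p / 2)) * f) := by
      have e : f ^ p = f ^ (p/2) * f ^ (p/2) * f := by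
        rw [← pow_add, ← pow_succ]; congr 1; omega
      rw [e]
      ring
    rw [this]; exact Dvd.dvd.mul_right h _
  have h2 : X ^ p ∣ f ^ p - C (f.eval 0) := by
    have e1 : f ^ p = expand (ZMod p) p f := (ZMod.expand_card f).symm
    have : f ^ p - C (f.eval 0) = expand (ZMod p) p (f - C (f.eval 0)) := by
      rw [e1]; simp
    rw [this]
    have h3 : X ∣ f - C (f.eval 0) := by
      rw [X_dvd_iff]; simp [coeff_zero_eq_eval_zero]
    obtain ⟨w, hw⟩ := h3
    rw [hw]; simp
  have h4 : X ^ p ∣ r ^ 2 * f - C (f.eval 0) * s ^ 2 := by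
    have : r ^ 2 * f - C (f.eval 0) * s ^ 2 = (r ^ 2 * f - s ^ 2 * f ^ p) + s ^ 2 * (f ^ p - C (f.eval 0)) := by ring
    rw [this]; exact dvd_add h1 (Dvd.dvd.mul_left h2 _)
  have h5 : r ^ 2 * f - C (f.eval 0) * s ^ 2 = 0 := by
    by_contra hne
    have := natDegree_le_of_dvd h4 hne
    rw [natDegree_X_pow] at this
    have h6 : (r ^ 2 * f - C (f.eval 0) * s ^ 2).natDegree ≤ 2 * (c-1) + d := by
      refine (natDegree_sub_le _ _).trans (max_le ?_ ?_)
      · refine natDegree_mul_le.trans ?_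
        have := natDegree_pow_le (p := r) (n := 2)
        omega
      · refine (natDegree_C_mul_le _ _).trans ?_
        have := natDegree_pow_le (p := s) (n := 2)
        omega
    omega
  exact parity f r s _ h0 z hodd (sub_eq_zero.mp h5)

lemma nonvanish (hp2 : p ≠ 2) (f : (ZMod p)[X]) (c d J : ℕ) (r s : ℕ → (ZMod p)[X]) (hd : f.natDegree ≤ d)
    (hc : 2 * c + d ≤ p) (hc0 : 0 < c)
    (hr : ∀ j, (r j).natDegree < c) (hs : ∀ j, (s j).natDegree < c) (h0 : f.eval 0 ≠ 0) (z : ZMod p)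
    (hodd : Odd (f.rootMultiplicity z))
    (h : ∑ j ∈ Finset.range J, X ^ (p * j) * (r j + s j * f ^ (p / 2)) = 0) :
    ∀ k < J, r k = 0 ∧ s k = 0 := by
  intro k
  induction k using Nat.strong_induction_on with
  | _ k ih =>
  intro hk
  apply key_dvd hp2 f (r k) (s k) c d hd hc hc0 (hr k) (hs k) h0 z hodd
  have h1 : X ^ (p * k) * X ^ p ∣ X ^ (p * k) * (r k + s k * f ^ (p / 2)) := by
    rw [← Finset.add_sum_erase _ _ (Finset.mem_range.mpr hk)] at h
    rw [eq_neg_of_add_eq_zero_left h, dvd_neg]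
    apply Finset.dvd_sum
    intro j hj
    simp only [Finset.mem_erase, Finset.mem_range] at hj
    rcases lt_or_gt_of_ne hj.1 with hlt | hgt
    · obtain ⟨a, b⟩ := ih j hlt hj.2
      simp [a, b]
    · apply Dvd.dvd.mul_right
      rw [← pow_add]
      apply pow_dvd_pow
      have := Nat.mul_le_mul_left p (Nat.succ_le_of_lt hgt)
      rw [Nat.succ_eq_add_one, mul_add, mul_one] at this
      exact this
  exact (mul_dvd_mul_iff_left (pow_ne_zero _ X_ne_zero)).mp h1

/-- the linear system has a nontrivial solution -/
lemma exists_sol (f : (ZMod p)[X]) (a m1 m2 : ZMod p) (c d J l : ℕ) (hd : f.natDegree ≤ d) (hc0 : 0 < c)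
    (hdim : l * (c + l * d + J) < 2 * (J * c)) :
    ∃ r s : ℕ → (ZMod p)[X], (∀ j, (r j).natDegree < c) ∧ (∀ j, (s j).natDegree < c) ∧
      (∃ j < J, r j ≠ 0 ∨ s j ≠ 0) ∧
      ∀ k < l, ∑ j ∈ Finset.range J, X ^ j * (D f m1 k (r j) + C a * D f m2 k (s j)) = 0 := by
  classical
  let M := c + l * d + J
  let φ : ((Fin J → degreeLT (ZMod p) c) × (Fin J → degreeLT (ZMod p) c)) →ₗ[ZMod p] (Fin l → Fin M → ZMod p) :=
    { toFun := fun v k i => (∑ j : Fin J, X ^ (j:ℕ) * (D f m1 k (v.1 j : (ZMod p)[X]) + C a * D f m2 k (v.2 j : (ZMod p)[X]))).coeff i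
      map_add' := by
        intro v w
        funext k i
        simp only [Prod.fst_add, Prod.snd_add, Pi.add_apply, Submodule.coe_add, map_add]
        rw [← coeff_add, ← Finset.sum_add_distrib]
        congr 1
        apply Finset.sum_congr rfl
        intros; ring
      map_smul' := by
        intro t v
        funext k i
        simp only [Prod.smul_fst, Prod.smul_snd, Pi.smul_apply, Submodule.coe_smul, map_smul, RingHom.id_apply]
        rw [← coeff_smul, Finset.smul_sum]
        congr 1
        apply Finset.sum_congr rfl
        intros
        simp only [smul_eq_C_mul]; ring }
  have hfin : Module.finrank (ZMod p) (Fin l → Fin M → ZMod p) < Module.finrank (ZMod p) ((Fin J → degreeLT (ZMod p) c) × (Fin J → degreeLT (ZMod p) c)) := by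
    have h1 : Module.finrank (ZMod p) (degreeLT (ZMod p) c) = c := by
      rw [(degreeLTEquiv (ZMod p) c).finrank_eq]; simp
    have : Module.Finite (ZMod p) (degreeLT (ZMod p) c) := Module.Finite.equiv (degreeLTEquiv (ZMod p) c).symm
    have h2 : Module.finrank (ZMod p) (Fin l → Fin M → ZMod p) = l * M := by
      rw [Module.finrank_pi_fintype]; simp
    have h3 : Module.finrank (ZMod p) (Fin J → degreeLT (ZMod p) c) = J * c := by
      rw [Module.finrank_pi_fintype]; simp [h1]
    rw [Module.finrank_prod, h2, h3]
    show l * (c + l * d + J) < _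
    omega
  have : Module.Finite (ZMod p) (degreeLT (ZMod p) c) := Module.Finite.equiv (degreeLTEquiv (ZMod p) c).symm
  have hker := LinearMap.ker_ne_bot_of_finrank_lt hfin (f := φ)
  obtain ⟨v, hv, hv0⟩ := (Submodule.ne_bot_iff _).mp hker
  have hdeg : ∀ q : degreeLT (ZMod p) c, (q : (ZMod p)[X]).natDegree < c := by
    intro q
    by_cases hq : (q : (ZMod p)[X]) = 0
    · rw [hq]; simpa
    · exact (natDegree_lt_iff_degree_lt hq).mpr (mem_degreeLT.mp q.2)
  let r : ℕ → (ZMod p)[X] := fun j => if h : j < J then (v.1 ⟨j, h⟩ : (ZMod p)[X]) else 0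
  let s : ℕ → (ZMod p)[X] := fun j => if h : j < J then (v.2 ⟨j, h⟩ : (ZMod p)[X]) else 0
  have hr : ∀ j, (r j).natDegree < c := by
    intro j; simp only [r]; split_ifs
    · exact hdeg _
    · simpa
  have hs : ∀ j, (s j).natDegree < c := by
    intro j; simp only [s]; split_ifs
    · exact hdeg _
    · simpa
  refine ⟨r, s, hr, hs, ?_, ?_⟩
  · by_contra hcon
    push Not at hcon
    apply hv0
    ext j : 2
    · have := (hcon j j.2).1
      simp only [r, j.2, dif_pos] at this
      simpa using this
    · have := (hcon j j.2).2
      simp only [s, j.2, dif_pos] at this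
      simpa using this
  · intro k hk
    have hz : ∀ i : ℕ, i < M → (∑ j ∈ Finset.range J, X ^ j * (D f m1 k (r j) + C a * D f m2 k (s j))).coeff i = 0 := by
      intro i hi
      have := congrFun (congrFun (LinearMap.mem_ker.mp hv) ⟨k, hk⟩) ⟨i, hi⟩
      rw [Finset.sum_range]
      simp only [r, s, Fin.is_lt, dif_pos, Fin.eta]
      exact this
    ext i
    rw [coeff_zero]
    by_cases hi : i < M
    · exact hz i hi
    · apply coeff_eq_zero_of_natDegree_lt
      refine lt_of_lt_of_le ?_ (not_lt.mp hi)
      refine lt_of_le_of_lt (natDegree_sum_le_of_forall_le (n := M - 1) _ _ ?_) ?_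
      · intro j hj
        rw [Finset.mem_range] at hj
        refine natDegree_mul_le.trans ?_
        rw [natDegree_X_pow]
        have h1 : (D f m1 k (r j) + C a * D f m2 k (s j)).natDegree ≤ (c - 1) + l * d := by
          have hkd : k * d ≤ l * d := Nat.mul_le_mul_right d hk.le
          refine (natDegree_add_le _ _).trans (max_le ?_ ?_)
          · have := D_deg f d hd m1 k (r j); have := hr j; omega
          · refine (natDegree_C_mul_le _ _).trans ?_
            have := D_deg f d hd m2 k (s j); have := hs j; omega
        show _ ≤ c + l * d + J - 1
        omega
      · show c + l * d + J - 1 < c + l * d + J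
        omega

lemma root_count (F : (ZMod p)[X]) (S : Finset (ZMod p)) (l : ℕ)
    (h : ∀ x ∈ S, l ≤ F.rootMultiplicity x) : S.card * l ≤ F.natDegree := by
  classical
  calc S.card * l ≤ ∑ x ∈ S, F.rootMultiplicity x := by
        rw [← smul_eq_mul]; exact Finset.card_nsmul_le_sum _ _ _ h
    _ = ∑ x ∈ S, F.roots.count x := by simp
    _ ≤ Multiset.card F.roots := by
          have := Finset.sum_le_sum_of_subset (f := fun x => F.roots.count x) (Finset.subset_union_left (s₁ := S) (s₂ := F.roots.toFinset))
          rwa [Multiset.sum_count_eq_card (s := S ∪ F.roots.toFinset) (m := F.roots) (by intro a ha; simp at ha ⊢; tauto)] at this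
    _ ≤ F.natDegree := card_roots' F

lemma stepanov_core (hp2 : p ≠ 2) (f : (ZMod p)[X]) (a : ZMod p) (c d J l : ℕ) (hd : f.natDegree ≤ d)
    (hc0 : 0 < c) (hc : 2 * c + d ≤ p) (hl : l ≤ p) (hl0 : 0 < l)
    (hdim : l * (c + l * d + J) < 2 * (J * c)) (h0 : f.eval 0 ≠ 0) (z : ZMod p)
    (hodd : Odd (f.rootMultiplicity z)) (S : Finset (ZMod p))
    (hS : ∀ x ∈ S, (f.eval x) ^ (p / 2) = a) :
    S.card * l ≤ d * l + c + d * (p/2) + J * p := by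
  classical
  obtain ⟨r, s, hr, hs, ⟨j0, hj0, hne⟩, hsol⟩ := exists_sol f a (l : ZMod p) ((l + p/2 : ℕ) : ZMod p) c d J l hd hc0 hdim
  set G := ∑ j ∈ Finset.range J, X ^ (p * j) * (r j + s j * f ^ (p / 2)) with hG
  have hGne : G ≠ 0 := by
    intro h
    have := nonvanish hp2 f c d J r s hd hc hc0 hr hs h0 z hodd h j0 hj0
    rcases hne with h | h
    · exact h this.1
    · exact h this.2
  have hf : f ≠ 0 := by rintro rfl; simp at h0
  have hF : f ^ l * G ≠ 0 := mul_ne_zero (pow_ne_zero _ hf) hGne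
  have hFe : f ^ l * G = ∑ j ∈ Finset.range J, X ^ (p * j) * (f ^ l * r j + f ^ (l + p/2) * s j) := by
    rw [hG, Finset.mul_sum]
    apply Finset.sum_congr rfl
    intros; ring
  have hroot : ∀ x ∈ S, l ≤ (f ^ l * G).rootMultiplicity x := by
    intro x hx
    obtain ⟨e, rfl⟩ : ∃ e, l = e + 1 := ⟨l - 1, by omega⟩
    apply Nat.succ_le_of_lt
    apply lt_rootMultiplicity_of_isRoot_iterate_derivative_of_mem_nonZeroDivisors hF
    · intro k hk
      rw [hFe, iterate_derivative_sum, IsRoot.def]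
      have hterm : ∀ j ∈ Finset.range J, eval x (derivative^[k] (X ^ (p * j) * (f ^ (e+1) * r j + f ^ (e+1 + p/2) * s j)))
          = (f.eval x) ^ (e+1-k) * eval x (X ^ j * (D f ((e+1 : ℕ) : ZMod p) k (r j) + C a * D f ((e+1 + p/2 : ℕ) : ZMod p) k (s j))) := by
        intro j _
        rw [deriv_X, iterate_map_add, D_spec f (e+1) k (by omega), D_spec f (e+1+p/2) k (by omega)]
        have : e + 1 + p/2 - k = (e + 1 - k) + p/2 := by omega
        rw [this]
        simp only [eval_mul, eval_pow, eval_X, eval_add, eval_C, pow_add, pow_mul, hS x hx]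
        have : x ^ p = x := ZMod.pow_card x
        rw [this]; ring
      rw [eval_finsetSum, Finset.sum_congr rfl hterm, ← Finset.mul_sum, ← eval_finsetSum, hsol k (by omega)]
      simp
    · rw [mem_nonZeroDivisors_iff_ne_zero]
      intro h
      rw [ZMod.natCast_eq_zero_iff, (Fact.out : p.Prime).dvd_factorial] at h
      omega
  refine (root_count _ S l hroot).trans ?_
  refine natDegree_mul_le.trans ?_
  have h1 : (f ^ l).natDegree ≤ d * l := by
    refine natDegree_pow_le.trans ?_
    rw [mul_comm]; exact Nat.mul_le_mul_right _ hd
  have h2 : G.natDegree ≤ c + d * (p/2) + J * p := by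
    apply natDegree_sum_le_of_forall_le
    intro j hj
    rw [Finset.mem_range] at hj
    refine natDegree_mul_le.trans ?_
    rw [natDegree_X_pow]
    have e1 : (r j + s j * f ^ (p/2)).natDegree ≤ c + d * (p/2) := by
      refine (natDegree_add_le _ _).trans (max_le ?_ ?_)
      · have := hr j; omega
      · refine natDegree_mul_le.trans ?_
        have e2 : (f ^ (p/2)).natDegree ≤ d * (p/2) := by
          refine natDegree_pow_le.trans ?_
          rw [mul_comm]; exact Nat.mul_le_mul_right _ hd
        have := hs j; omega
    have e3 : p * j ≤ J * p := by rw [mul_comm]; exact Nat.mul_le_mul_right _ hj.le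
    omega
  omega


/-- Numerical form of the Stepanov bound. -/
lemma stepanov_num (hp2 : p ≠ 2) (f : (ZMod p)[X]) (a : ZMod p) (d : ℕ) (hd : f.natDegree ≤ d)
    (hd1 : 1 ≤ d) (hpd : 1600 * d ^ 2 ≤ p) (h0 : f.eval 0 ≠ 0) (z : ZMod p)
    (hodd : Odd (f.rootMultiplicity z)) (S : Finset (ZMod p))
    (hS : ∀ x ∈ S, (f.eval x) ^ (p / 2) = a) :
    (S.card : ℝ) ≤ p / 2 + 20 * d * √p := by
  set l := Nat.sqrt p with hl
  have hl1 : l * l ≤ p := Nat.sqrt_le p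
  have hl2 : p < (l+1) * (l+1) := Nat.lt_succ_sqrt p
  have hl40 : 40 * d ≤ l := by
    rw [hl, Nat.le_sqrt]; nlinarith
  have hlp : l ≤ p := Nat.sqrt_le_self p
  set c := (p - d) / 2 with hc
  set J := l / 2 + 4 * d with hJ
  have hdp : 40 * d ≤ p := by omega
  have hc1 : 2 * c + d ≤ p := by omega
  have hc2 : p ≤ 2 * c + d + 1 := by omega
  have hJ1 : l + 8 * d ≤ 2 * J + 1 := by omega
  have hJ2 : 2 * J ≤ l + 8 * d := by omega
  have hdim : l * (c + l * d + J) < 2 * (J * c) := by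
    -- 2 J c ≥ c (l + 8 d - 1)
    have h1 : c * (l + 8 * d) ≤ c * (2 * J + 1) := Nat.mul_le_mul_left _ hJ1
    have h2 : 4 * p ≤ 9 * c := by omega
    have h3 : l * l * d ≤ p * d := Nat.mul_le_mul_right _ hl1
    have h4 : l * (2 * J) ≤ l * (l + 8 * d) := Nat.mul_le_mul_left _ hJ2
    have h5 : l * (40 * d) ≤ l * l := Nat.mul_le_mul_left _ hl40
    have h6 : p * 1 ≤ p * d := Nat.mul_le_mul_left _ hd1
    have h7 : 4 * p * d ≤ 9 * c * d := Nat.mul_le_mul_right _ h2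
    have h8 : c * 1 ≤ c * d := Nat.mul_le_mul_left _ hd1
    have h9 : 0 < c := by omega
    nlinarith
  have hcore := stepanov_core hp2 f a c d J l hd (by omega) hc1 hlp (by omega) hdim h0 z hodd S hS
  have hlr : √(p:ℝ) ≤ 2 * l := by
    rw [Real.sqrt_le_left (by positivity)]
    have : p ≤ (2 * l)^2 := by nlinarith
    exact_mod_cast this
  have hsq : √(p:ℝ) * √(p:ℝ) = p := Real.mul_self_sqrt (by positivity)
  have hs0 : 0 ≤ √(p:ℝ) := Real.sqrt_nonneg _
  have hcore2 : 2 * (S.card * l) ≤ 2 * (d * l) + p + d * p + (l + 8 * d) * p := by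
    have e1 : 2 * (d * (p/2)) ≤ d * p := by
      calc 2 * (d * (p/2)) = d * (2 * (p/2)) := by ring
        _ ≤ d * p := Nat.mul_le_mul_left _ (by omega)
    have e2 : 2 * (J * p) ≤ (l + 8 * d) * p := by
      calc 2 * (J * p) = (2 * J) * p := by ring
        _ ≤ _ := Nat.mul_le_mul_right _ hJ2
    omega
  have hr : 2 * ((S.card : ℝ) * l) ≤ 2 * (d * l) + p + d * p + (l + 8 * d) * p := by exact_mod_cast hcore2
  have hl0 : (0:ℝ) < l := by
    have : 0 < l := by omega
    exact_mod_cast this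
  have hd1r : (1:ℝ) ≤ d := by exact_mod_cast hd1
  have hp1 : (1:ℝ) ≤ √p := by
    rw [Real.one_le_sqrt]
    have : 1 ≤ p := by omega
    exact_mod_cast this
  have hppl : (p:ℝ) ≤ 2 * l * √p := by
    have := mul_le_mul_of_nonneg_right hlr hs0
    rwa [hsq] at this
  have : (S.card : ℝ) * l ≤ (p / 2 + 20 * d * √p) * l := by
    have e1 : (d:ℝ) * p ≤ d * (2 * l * √p) := mul_le_mul_of_nonneg_left hppl (by positivity)
    have e2 : (p:ℝ) ≤ d * p := le_mul_of_one_le_left (by positivity) hd1r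
    have e3 : (d:ℝ) * l ≤ d * l * √p := le_mul_of_one_le_right (by positivity) hp1
    nlinarith
  exact le_of_mul_le_mul_right this hl0

lemma weil0 (hp2 : p ≠ 2) (f : (ZMod p)[X]) (d : ℕ) (hd : f.natDegree ≤ d)
    (hd1 : 1 ≤ d) (h0 : f.eval 0 ≠ 0) (z : ZMod p)
    (hodd : Odd (f.rootMultiplicity z)) :
    |(∑ x : ZMod p, ((quadraticChar (ZMod p) (f.eval x) : ℤ) : ℝ))| ≤ 50 * d * √p := by
  classical
  have hsq : √(p:ℝ) * √(p:ℝ) = p := Real.mul_self_sqrt (by positivity)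
  have hs0 : 0 ≤ √(p:ℝ) := Real.sqrt_nonneg _
  have hd1r : (1:ℝ) ≤ d := by exact_mod_cast hd1
  have hbd : ∀ y : ZMod p, |((quadraticChar (ZMod p) y : ℤ) : ℝ)| ≤ 1 := by
    intro y
    by_cases hy : y = 0
    · simp [hy]
    · rcases quadraticChar_dichotomy hy with h | h <;> simp [h]
  by_cases hpd : 1600 * d ^ 2 ≤ p
  swap
  · have h1 : |(∑ x : ZMod p, ((quadraticChar (ZMod p) (f.eval x) : ℤ) : ℝ))| ≤ p := by
      refine (Finset.abs_sum_le_sum_abs _ _).trans ?_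
      refine (Finset.sum_le_sum (fun x _ => hbd _)).trans ?_
      simp [ZMod.card]
    have h2 : √(p:ℝ) ≤ 50 * d := by
      rw [Real.sqrt_le_left (by positivity)]
      have : p ≤ (50 * d)^2 := by nlinarith
      exact_mod_cast this
    nlinarith
  · have hchar : ringChar (ZMod p) ≠ 2 := by rwa [ZMod.ringChar_zmod_n]
    set S1 := Finset.univ.filter (fun x : ZMod p => quadraticChar (ZMod p) (f.eval x) = 1) with hS1
    set S2 := Finset.univ.filter (fun x : ZMod p => quadraticChar (ZMod p) (f.eval x) = -1) with hS2
    set S0 := Finset.univ.filter (fun x : ZMod p => f.eval x = 0) with hS0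
    have b1 := stepanov_num hp2 f 1 d hd hd1 hpd h0 z hodd S1 (by
      intro x hx
      have := (Finset.mem_filter.mp hx).2
      have h := quadraticChar_eq_pow_of_char_ne_two' hchar (f.eval x)
      rw [this, ZMod.card] at h
      rw [← h]; simp)
    have b2 := stepanov_num hp2 f (-1) d hd hd1 hpd h0 z hodd S2 (by
      intro x hx
      have := (Finset.mem_filter.mp hx).2
      have h := quadraticChar_eq_pow_of_char_ne_two' hchar (f.eval x)
      rw [this, ZMod.card] at h
      rw [← h]; simp)
    have hf : f ≠ 0 := by rintro rfl; simp at h0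
    have b0 : (S0.card : ℝ) ≤ d := by
      have : S0 ⊆ f.roots.toFinset := by
        intro x hx
        simp only [Multiset.mem_toFinset, mem_roots hf, IsRoot.def]
        exact (Finset.mem_filter.mp hx).2
      have := (Finset.card_le_card this).trans ((Multiset.toFinset_card_le _).trans ((card_roots' f).trans hd))
      exact_mod_cast this
    have hpt : ∀ x : ZMod p, ((quadraticChar (ZMod p) (f.eval x) : ℤ) : ℝ) =
        (if quadraticChar (ZMod p) (f.eval x) = 1 then 1 else 0) - (if quadraticChar (ZMod p) (f.eval x) = -1 then 1 else 0) := by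
      intro x
      by_cases hy : f.eval x = 0
      · simp [hy]
      · rcases quadraticChar_dichotomy hy with h | h <;> norm_num [h]
    have hpt1 : ∀ x : ZMod p, (1:ℝ) = (if quadraticChar (ZMod p) (f.eval x) = 1 then 1 else 0) + (if quadraticChar (ZMod p) (f.eval x) = -1 then 1 else 0) + (if f.eval x = 0 then 1 else 0) := by
      intro x
      by_cases hy : f.eval x = 0
      · simp [hy]
      · rcases quadraticChar_dichotomy hy with h | h <;> norm_num [h, hy]
    have hsum : (∑ x : ZMod p, ((quadraticChar (ZMod p) (f.eval x) : ℤ) : ℝ)) = S1.card - S2.card := by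
      rw [Finset.sum_congr rfl (fun x _ => hpt x), Finset.sum_sub_distrib, Finset.sum_boole, Finset.sum_boole]
    have htot : (p:ℝ) = S1.card + S2.card + S0.card := by
      have : (p:ℝ) = ∑ x : ZMod p, (1:ℝ) := by simp [ZMod.card]
      rw [this, Finset.sum_congr rfl (fun x _ => hpt1 x), Finset.sum_add_distrib, Finset.sum_add_distrib, Finset.sum_boole, Finset.sum_boole, Finset.sum_boole]
    have hp1 : (1:ℝ) ≤ √p := by
      rw [Real.one_le_sqrt]
      have : 1 ≤ p := (Fact.out : p.Prime).one_lt.le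
      exact_mod_cast this
    have hds : (d:ℝ) ≤ d * √p := le_mul_of_one_le_right (by positivity) hp1
    rw [hsum, abs_le]
    constructor <;> nlinarith

end Stp
end

section
open Polynomial

namespace Stp
variable {p : ℕ} [Fact p.Prime]

/-- the Legendre symbol as a real number -/
noncomputable def chi (p : ℕ) [Fact p.Prime] (x : ZMod p) : ℝ := ((quadraticChar (ZMod p) x : ℤ) : ℝ)

lemma chi_mul (x y : ZMod p) : chi p (x * y) = chi p x * chi p y := by
  unfold chi; rw [map_mul]; push_cast; ring

lemma chi_abs_le (x : ZMod p) : |chi p x| ≤ 1 := by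
  unfold chi
  by_cases hy : x = 0
  · simp [hy]
  · rcases quadraticChar_dichotomy hy with h | h <;> simp [h]

lemma chi_prod {ι : Type*} (s : Finset ι) (g : ι → ZMod p) : chi p (∏ i ∈ s, g i) = ∏ i ∈ s, chi p (g i) := by
  simp [chi]

open Classical in
/-- tuples with all multiplicities even -/
lemma bad_card (r V : ℕ) (hr : 1 ≤ r) :
    ((Fintype.piFinset (fun _ : Fin (2*r) => Finset.Icc 1 V)).filter
      (fun t => ∀ v, Even (Finset.univ.filter (fun i => t i = v)).card)).card ≤ r ^ (2*r) * V ^ r := by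
  classical
  have hsub : ((Fintype.piFinset (fun _ : Fin (2*r) => Finset.Icc 1 V)).filter
      (fun t => ∀ v, Even (Finset.univ.filter (fun i => t i = v)).card)) ⊆
      ((Finset.univ : Finset (Fin (2*r) → Fin r)) ×ˢ (Fintype.piFinset (fun _ : Fin r => Finset.Icc 1 V))).image
        (fun wu => fun i => wu.2 (wu.1 i)) := by
    intro t ht
    rw [Finset.mem_filter, Fintype.mem_piFinset] at ht
    obtain ⟨ht1, ht2⟩ := ht
    set I := Finset.univ.image t with hI
    have hcard : I.card ≤ r := by
      have h1 : (Finset.univ : Finset (Fin (2*r))).card = ∑ v ∈ I, (Finset.univ.filter (fun i => t i = v)).card :=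
        Finset.card_eq_sum_card_image t _
      have h2 : ∑ v ∈ I, 2 ≤ ∑ v ∈ I, (Finset.univ.filter (fun i => t i = v)).card := by
        apply Finset.sum_le_sum
        intro v hv
        obtain ⟨i, _, hi⟩ := Finset.mem_image.mp hv
        have h3 : 0 < (Finset.univ.filter (fun i => t i = v)).card := Finset.card_pos.mpr ⟨i, by simp [hi]⟩
        obtain ⟨k, hk⟩ := ht2 v
        omega
      rw [← h1] at h2
      simp at h2
      omega
    rw [Finset.mem_image]
    refine ⟨(fun i => Fin.castLE hcard (I.equivFin ⟨t i, Finset.mem_image_of_mem _ (Finset.mem_univ _)⟩),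
      fun j => if h : (j : ℕ) < I.card then (I.equivFin.symm ⟨j, h⟩ : ℕ) else t ⟨0, by omega⟩), ?_, ?_⟩
    · rw [Finset.mem_product]
      refine ⟨Finset.mem_univ _, ?_⟩
      rw [Fintype.mem_piFinset]
      intro j
      dsimp only
      split_ifs with h
      · obtain ⟨i, _, hi⟩ := Finset.mem_image.mp (I.equivFin.symm ⟨j, h⟩).2
        rw [← hi]; exact ht1 i
      · exact ht1 _
    · funext i
      simp
  refine (Finset.card_le_card hsub).trans (Finset.card_image_le.trans ?_)
  rw [Finset.card_product]
  simp

lemma tuple_sum (hp2 : p ≠ 2) (n V : ℕ) (hn : 1 ≤ n) (hV : V < p) (t : Fin n → ℕ) (ht : ∀ i, t i ∈ Finset.Icc 1 V)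
    (v : ℕ) (hv : ¬ Even (Finset.univ.filter (fun i => t i = v)).card) :
    |∑ x : ZMod p, ∏ i, chi p (x + (t i : ZMod p))| ≤ 50 * n * √p := by
  classical
  set s : Multiset (ZMod p) := Finset.univ.val.map (fun i => -(t i : ZMod p)) with hs
  set f : (ZMod p)[X] := (s.map (fun a => X - C a)).prod with hf
  have hfe : ∀ x, f.eval x = ∏ i, (x + (t i : ZMod p)) := by
    intro x
    rw [hf, hs, eval_multiset_prod, Multiset.map_map, Multiset.map_map]
    simp [Finset.prod]
  have hdeg : f.natDegree ≤ n := by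
    rw [hf, natDegree_multiset_prod_X_sub_C_eq_card, hs]; simp
  have h0 : f.eval 0 ≠ 0 := by
    rw [hfe, Finset.prod_ne_zero_iff]
    intro i _
    rw [zero_add, Ne, ZMod.natCast_eq_zero_iff]
    have := Finset.mem_Icc.mp (ht i)
    intro h
    have := Nat.le_of_dvd (by omega) h
    omega
  have hvp : v < p := by
    have : (Finset.univ.filter (fun i => t i = v)).card ≠ 0 := by
      intro h; rw [h] at hv; simp at hv
    obtain ⟨i, hi⟩ := Finset.card_pos.mp (Nat.pos_of_ne_zero this)
    have h1 := (Finset.mem_filter.mp hi).2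
    have := Finset.mem_Icc.mp (ht i)
    omega
  have hodd : Odd (f.rootMultiplicity (-(v : ZMod p))) := by
    rw [← count_roots, hf, roots_multiset_prod_X_sub_C, hs, Multiset.count_map]
    have : (Multiset.filter (fun a => -(v : ZMod p) = -(t a : ZMod p)) Finset.univ.val).card = (Finset.univ.filter (fun i => t i = v)).card := by
      rw [Finset.card_def, Finset.filter_val]
      congr 1
      apply Multiset.filter_congr
      intro i _
      rw [neg_inj]
      have := Finset.mem_Icc.mp (ht i)
      constructor
      · intro h
        rw [ZMod.natCast_eq_natCast_iff', Nat.mod_eq_of_lt hvp, Nat.mod_eq_of_lt (by omega)] at h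
        exact h.symm
      · intro h; rw [h]
    rw [this]
    exact Nat.not_even_iff_odd.mp hv
  have := weil0 hp2 f n hdeg hn h0 _ hodd
  convert this using 3 with x _
  rw [hfe, ← chi_prod]; rfl

lemma moment (hp2 : p ≠ 2) (r V : ℕ) (hr : 1 ≤ r) (hV : V < p) :
    ∑ x : ZMod p, (∑ v ∈ Finset.Icc 1 V, chi p (x + (v : ZMod p))) ^ (2 * r) ≤
      (r:ℝ) ^ (2*r) * (V:ℝ) ^ r * p + 100 * r * (V:ℝ) ^ (2*r) * √p := by
  classical
  have h1 : ∀ x : ZMod p, (∑ v ∈ Finset.Icc 1 V, chi p (x + (v : ZMod p))) ^ (2 * r) =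
      ∑ t ∈ Fintype.piFinset (fun _ : Fin (2*r) => Finset.Icc 1 V), ∏ i, chi p (x + (t i : ZMod p)) := by
    intro x
    rw [← Finset.prod_univ_sum (fun _ : Fin (2*r) => Finset.Icc 1 V) (fun _ v => chi p (x + (v : ZMod p)))]
    simp
  rw [Finset.sum_congr rfl (fun x _ => h1 x), Finset.sum_comm]
  set B := Fintype.piFinset (fun _ : Fin (2*r) => Finset.Icc 1 V) with hB
  rw [← Finset.sum_filter_add_sum_filter_not B (fun t => ∀ v, Even (Finset.univ.filter (fun i => t i = v)).card)]
  apply add_le_add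
  · have hb := bad_card r V hr
    have : ∀ t ∈ B.filter (fun t => ∀ v, Even (Finset.univ.filter (fun i => t i = v)).card),
        ∑ x : ZMod p, ∏ i, chi p (x + (t i : ZMod p)) ≤ p := by
      intro t _
      have : ∀ x ∈ (Finset.univ : Finset (ZMod p)), ∏ i, chi p (x + (t i : ZMod p)) ≤ 1 := by
        intro x _
        rw [← chi_prod]
        exact (le_abs_self _).trans (chi_abs_le _)
      refine (Finset.sum_le_sum this).trans ?_
      simp [ZMod.card]
    refine (Finset.sum_le_sum this).trans ?_
    rw [Finset.sum_const, nsmul_eq_mul]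
    apply mul_le_mul_of_nonneg_right _ (by positivity)
    exact_mod_cast hb
  · have : ∀ t ∈ B.filter (fun t => ¬ ∀ v, Even (Finset.univ.filter (fun i => t i = v)).card),
        ∑ x : ZMod p, ∏ i, chi p (x + (t i : ZMod p)) ≤ 100 * r * √p := by
      intro t ht
      rw [Finset.mem_filter, hB, Fintype.mem_piFinset] at ht
      obtain ⟨ht1, ht2⟩ := ht
      push Not at ht2
      obtain ⟨v, hv⟩ := ht2
      have := tuple_sum hp2 (2*r) V (by omega) hV t ht1 v hv
      refine (le_abs_self _).trans (this.trans (le_of_eq ?_))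
      push_cast; ring
    refine (Finset.sum_le_sum this).trans ?_
    rw [Finset.sum_const, nsmul_eq_mul]
    have hc : ((B.filter (fun t => ¬ ∀ v, Even (Finset.univ.filter (fun i => t i = v)).card)).card : ℝ) ≤ (V:ℝ)^(2*r) := by
      have : (B.filter (fun t => ¬ ∀ v, Even (Finset.univ.filter (fun i => t i = v)).card)).card ≤ V ^ (2*r) := by
        refine (Finset.card_filter_le _ _).trans ?_
        rw [hB]; simp
      exact_mod_cast this
    calc _ ≤ (V:ℝ)^(2*r) * (100 * r * √p) := mul_le_mul_of_nonneg_right hc (by positivity)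
      _ = _ := by ring

end Stp
end

section
namespace Stp
variable {p : ℕ} [Fact p.Prime]

/-- data of a pair of triples `((a1,b1,u1),(a2,b2,u2))` -/
def Mv (t : (ℕ × ℕ × ℕ) × (ℕ × ℕ × ℕ)) : ℤ := (t.2.1 : ℤ) * t.2.2.2 - (t.1.1 : ℤ) * t.1.2.2
/-- companion value -/
def Nv (t : (ℕ × ℕ × ℕ) × (ℕ × ℕ × ℕ)) : ℤ :=
  (t.1.1 : ℤ) * t.2.1 * ((t.1.2.1 : ℤ) * t.2.2.2 - (t.2.2.1 : ℤ) * t.1.2.2)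

/-- basic range condition for a triple -/
def Good (N U : ℕ) (x : ℕ × ℕ × ℕ) : Prop :=
  x.1.Prime ∧ U < x.1 ∧ x.1 ≤ N ∧ 1 ≤ x.2.1 ∧ x.2.1 ≤ N ∧ 1 ≤ x.2.2 ∧ x.2.2 ≤ U

lemma Mv_bound {N U : ℕ} {t : (ℕ × ℕ × ℕ) × (ℕ × ℕ × ℕ)} (h1 : Good N U t.1) (h2 : Good N U t.2) :
    |Mv t| ≤ N * U := by
  obtain ⟨⟨a1, b1, u1⟩, ⟨a2, b2, u2⟩⟩ := t
  obtain ⟨_, _, ha1, _, hb1, _, hu1⟩ := h1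
  obtain ⟨_, _, ha2, _, hb2, _, hu2⟩ := h2
  simp only [Mv] at *
  have e1 : (a1:ℤ) * u1 ≤ N * U := by exact_mod_cast Nat.mul_le_mul ha1 hu1
  have e2 : (a2:ℤ) * u2 ≤ N * U := by exact_mod_cast Nat.mul_le_mul ha2 hu2
  have e3 : (0:ℤ) ≤ a1 * u1 := by positivity
  have e4 : (0:ℤ) ≤ a2 * u2 := by positivity
  rw [abs_le]; constructor <;> linarith

lemma Nv_bound {N U : ℕ} {t : (ℕ × ℕ × ℕ) × (ℕ × ℕ × ℕ)} (h1 : Good N U t.1) (h2 : Good N U t.2) :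
    |Nv t| ≤ N ^ 3 * U := by
  obtain ⟨⟨a1, b1, u1⟩, ⟨a2, b2, u2⟩⟩ := t
  obtain ⟨_, _, ha1, _, hb1, _, hu1⟩ := h1
  obtain ⟨_, _, ha2, _, hb2, _, hu2⟩ := h2
  simp only [Nv] at *
  have e1 : (b1:ℤ) * u2 ≤ N * U := by exact_mod_cast Nat.mul_le_mul hb1 hu2
  have e2 : (b2:ℤ) * u1 ≤ N * U := by exact_mod_cast Nat.mul_le_mul hb2 hu1
  have e3 : (0:ℤ) ≤ b1 * u2 := by positivity
  have e4 : (0:ℤ) ≤ b2 * u1 := by positivity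
  have e5 : |(b1:ℤ) * u2 - b2 * u1| ≤ N * U := by
    rw [abs_le]; constructor <;> linarith
  have e6 : (a1:ℤ) * a2 ≤ N * N := by exact_mod_cast Nat.mul_le_mul ha1 ha2
  rw [abs_mul, abs_of_nonneg (by positivity : (0:ℤ) ≤ a1 * a2)]
  calc (a1:ℤ) * a2 * |(b1:ℤ) * u2 - b2 * u1| ≤ (N * N) * (N * U) := by gcongr
    _ = _ := by ring

open Classical in
/-- integer determined by `M` -/
noncomputable def Nf (p : ℕ) (k : ZMod p) (N U : ℕ) (M : ℤ) : ℤ :=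
  if h : ∃ n : ℤ, |n| ≤ N ^ 3 * U ∧ (n : ZMod p) = k * (M : ZMod p) then h.choose else 0

lemma Nf_abs (k : ZMod p) (N U : ℕ) (M : ℤ) : |Nf p k N U M| ≤ N ^ 3 * U := by
  unfold Nf
  split_ifs with h
  · exact h.choose_spec.1
  · simp; positivity

lemma Nf_eq (k : ZMod p) (N U : ℕ) (hsz : 2 * (N ^ 3 * U) < p) (M n : ℤ) (hn : |n| ≤ N ^ 3 * U)
    (h : (n : ZMod p) = k * (M : ZMod p)) : Nf p k N U M = n := by
  have hex : ∃ n : ℤ, |n| ≤ N ^ 3 * U ∧ (n : ZMod p) = k * (M : ZMod p) := ⟨n, hn, h⟩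
  have h1 : Nf p k N U M = hex.choose := by unfold Nf; rw [dif_pos hex]
  obtain ⟨h2, h3⟩ := hex.choose_spec
  rw [h1]
  have h4 : ((hex.choose - n : ℤ) : ZMod p) = 0 := by push_cast; rw [h3, h]; ring
  rw [ZMod.intCast_zmod_eq_zero_iff_dvd] at h4
  have h5 : |hex.choose - n| < p := by
    have : |hex.choose - n| ≤ |hex.choose| + |n| := abs_sub _ _
    have hz : (2 * ((N:ℤ) ^ 3 * U)) < p := by exact_mod_cast hsz
    linarith
  have := Int.eq_zero_of_abs_lt_dvd h4 h5
  linarith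

lemma cong_of_eq (k : ZMod p) (N U : ℕ) (hNp : N < p) (hUN : U ≤ N) (t : (ℕ × ℕ × ℕ) × (ℕ × ℕ × ℕ))
    (h1 : Good N U t.1) (h2 : Good N U t.2)
    (h : ((t.1.2.1 : ZMod p) - k * (t.1.1 : ZMod p)⁻¹) * (t.1.2.2 : ZMod p)⁻¹ =
      ((t.2.2.1 : ZMod p) - k * (t.2.1 : ZMod p)⁻¹) * (t.2.2.2 : ZMod p)⁻¹) :
    ((Nv t : ℤ) : ZMod p) = k * ((Mv t : ℤ) : ZMod p) := by
  obtain ⟨⟨a1, b1, u1⟩, ⟨a2, b2, u2⟩⟩ := t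
  obtain ⟨_, _, ha1, _, hb1, _, hu1⟩ := h1
  obtain ⟨_, _, ha2, _, hb2, _, hu2⟩ := h2
  simp only [Nv, Mv] at *
  have nz : ∀ m : ℕ, 0 < m → m ≤ N → (m : ZMod p) ≠ 0 := by
    intro m hm hmN h
    rw [ZMod.natCast_eq_zero_iff] at h
    have := Nat.le_of_dvd hm h
    omega
  have n1 := nz a1 (by omega) ha1
  have n2 := nz a2 (by omega) ha2
  have n3 := nz u1 (by omega) (by omega)
  have n4 := nz u2 (by omega) (by omega)
  field_simp at h
  push_cast
  linear_combination h

lemma count (k : ZMod p) (hk : k ≠ 0) (N U Dv : ℕ) (hU : 1 ≤ U) (hUN : U ≤ N) (hD1 : 1 ≤ Dv)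
    (hsz : 2 * (N ^ 3 * U) < p)
    (hD : ∀ n : ℕ, n < p → n.divisors.card ≤ Dv)
    (A : Finset ℕ) (hA : ∀ a ∈ A, a.Prime ∧ U < a ∧ a ≤ N) :
    (((A ×ˢ Finset.Icc 1 N ×ˢ Finset.Icc 1 U) ×ˢ (A ×ˢ Finset.Icc 1 N ×ˢ Finset.Icc 1 U)).filter
      (fun t => ((t.1.2.1 : ZMod p) - k * (t.1.1 : ZMod p)⁻¹) * (t.1.2.2 : ZMod p)⁻¹ =
      ((t.2.2.1 : ZMod p) - k * (t.2.1 : ZMod p)⁻¹) * (t.2.2.2 : ZMod p)⁻¹)).card ≤ 10 * (N ^ 2 * U * Dv ^ 2) := by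
  classical
  set T := A ×ˢ Finset.Icc 1 N ×ˢ Finset.Icc 1 U with hT
  set P := (T ×ˢ T).filter
      (fun t => ((t.1.2.1 : ZMod p) - k * (t.1.1 : ZMod p)⁻¹) * (t.1.2.2 : ZMod p)⁻¹ =
      ((t.2.2.1 : ZMod p) - k * (t.2.1 : ZMod p)⁻¹) * (t.2.2.2 : ZMod p)⁻¹) with hP
  have hN1 : 1 ≤ N := by omega
  have hN23 : N ^ 2 * U ≤ N ^ 3 * U := Nat.mul_le_mul_right _ (Nat.pow_le_pow_right hN1 (by norm_num))
  have hN12 : N * U ≤ N ^ 2 * U := Nat.mul_le_mul_right _ (by nlinarith)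
  have hNU : N ≤ N * U := by nlinarith
  have hNp : N < p := by omega
  have hgood : ∀ x ∈ T, Good N U x := by
    rintro ⟨a, b, u⟩ hx
    simp only [hT, Finset.mem_product, Finset.mem_Icc] at hx
    obtain ⟨h1, h2, h3⟩ := hA a hx.1
    exact ⟨h1, h2, h3, hx.2.1.1, hx.2.1.2, hx.2.2.1, hx.2.2.2⟩
  have hPg : ∀ t ∈ P, Good N U t.1 ∧ Good N U t.2 ∧ Nf p k N U (Mv t) = Nv t ∧ (Mv t = 0 → Nv t = 0) ∧ (Mv t ≠ 0 → Nv t ≠ 0) := by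
    intro t ht
    rw [hP, Finset.mem_filter, Finset.mem_product] at ht
    have g1 := hgood _ ht.1.1
    have g2 := hgood _ ht.1.2
    have hc := cong_of_eq k N U hNp hUN t g1 g2 ht.2
    have hf := Nf_eq k N U hsz (Mv t) (Nv t) (Nv_bound g1 g2) hc
    refine ⟨g1, g2, hf, ?_, ?_⟩
    · intro h0
      rw [h0] at hc
      simp only [Int.cast_zero, mul_zero] at hc
      rw [ZMod.intCast_zmod_eq_zero_iff_dvd] at hc
      apply Int.eq_zero_of_abs_lt_dvd hc
      have := Nv_bound g1 g2
      have hz : (2 * ((N:ℤ) ^ 3 * U)) < p := by exact_mod_cast hsz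
      have : (0:ℤ) ≤ (N:ℤ)^3 * U := by positivity
      linarith
    · intro h0 h1
      apply h0
      rw [h1] at hc
      simp only [Int.cast_zero] at hc
      have hc2 := (mul_eq_zero.mp hc.symm).resolve_left hk
      rw [ZMod.intCast_zmod_eq_zero_iff_dvd] at hc2
      apply Int.eq_zero_of_abs_lt_dvd hc2
      have := Mv_bound g1 g2
      have hz : ((N:ℤ) * U) < p := by
        have : N * U < p := by omega
        exact_mod_cast this
      linarith
  have hDN : ∀ M, (Nf p k N U M).natAbs.divisors.card ≤ Dv := by
    intro M
    apply hD
    have := Nf_abs k N U M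
    zify
    have hz : (2 * ((N:ℤ) ^ 3 * U)) < p := by exact_mod_cast hsz
    have : (0:ℤ) ≤ (N:ℤ)^3 * U := by positivity
    linarith
  set IM : Finset ℤ := Finset.Icc (-((N*U : ℕ):ℤ)) ((N * U : ℕ):ℤ) with hIM
  have hIMc : IM.card = 2 * (N*U) + 1 := by rw [hIM, Int.card_Icc]; omega
  have hMI : ∀ t ∈ P, Mv t ∈ IM := by
    intro t ht
    obtain ⟨g1, g2, _⟩ := hPg t ht
    have := abs_le.mp (Mv_bound g1 g2)
    rw [hIM, Finset.mem_Icc]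
    push_cast; exact this
  -- four classes
  set P1 := P.filter (fun t => Mv t = 0) with hP1
  set P2 := P.filter (fun t => Mv t ≠ 0 ∧ t.1.1 ≠ t.2.1) with hP2
  set P3 := P.filter (fun t => Mv t ≠ 0 ∧ t.1.1 = t.2.1 ∧ t.1.2.1 ≠ t.2.2.1) with hP3
  set P4 := P.filter (fun t => Mv t ≠ 0 ∧ t.1.1 = t.2.1 ∧ t.1.2.1 = t.2.2.1) with hP4
  have hcover : P ⊆ P1 ∪ (P2 ∪ (P3 ∪ P4)) := by
    intro t ht
    simp only [hP1, hP2, hP3, hP4, Finset.mem_union, Finset.mem_filter]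
    tauto
  have c1 : P1.card ≤ (N * N * U) * Dv := by
    have hcT : T.card ≤ N * N * U := by
      rw [hT, Finset.card_product, Finset.card_product]
      simp only [Nat.card_Icc, Nat.add_sub_cancel]
      have : A.card ≤ N := by
        have : A ⊆ Finset.Icc 1 N := by
          intro a ha
          obtain ⟨h1, h2, h3⟩ := hA a ha
          exact Finset.mem_Icc.mpr ⟨h1.one_lt.le, h3⟩
        simpa using Finset.card_le_card this
      calc A.card * (N * U) ≤ N * (N * U) := Nat.mul_le_mul_right _ this
        _ = _ := by ring
    have h1 : P1.card ≤ (T.sigma (fun x => (x.1 * x.2.2).divisors)).card := by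
      apply Finset.card_le_card_of_injOn (fun t => ⟨(t.2.1, t.1.2.1, t.2.2.2), t.1.1⟩)
      · intro t ht
        have ht := Finset.mem_coe.mp ht
        rw [hP1, Finset.mem_filter] at ht
        obtain ⟨g1, g2, _⟩ := hPg t ht.1
        have hm := (Finset.mem_filter.mp ht.1).1
        obtain ⟨⟨a1, b1, u1⟩, ⟨a2, b2, u2⟩⟩ := t
        simp only [hT, Finset.mem_product, Mv] at ht hm
        simp only [Finset.coe_sigma, Set.mem_sigma_iff, Finset.mem_coe, hT, Finset.mem_product, Nat.mem_divisors]
        obtain ⟨_, _, ha1, _, hb1, hu1', hu1⟩ := g1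
        obtain ⟨hap2, _, ha2, _, hb2, hu2', hu2⟩ := g2
        simp only at *
        refine ⟨⟨hm.2.1, hm.1.2.1, hm.2.2.2⟩, ⟨u1, ?_⟩, ?_⟩
        · have := ht.2; zify; linarith
        · have := hap2.pos; positivity
      · intro t ht t' ht' heq
        have ht := Finset.mem_coe.mp ht
        have ht' := Finset.mem_coe.mp ht'
        rw [hP1, Finset.mem_filter] at ht ht'
        obtain ⟨g1, g2, _, hz, _⟩ := hPg t ht.1
        obtain ⟨g1', g2', _, hz', _⟩ := hPg t' ht'.1
        have m1 := ht.2
        have m2 := ht'.2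
        have z1 := hz m1
        have z2 := hz' m2
        obtain ⟨⟨a1, b1, u1⟩, ⟨a2, b2, u2⟩⟩ := t
        obtain ⟨⟨a1', b1', u1'⟩, ⟨a2', b2', u2'⟩⟩ := t'
        simp only [Sigma.mk.injEq, Prod.mk.injEq, heq_eq_eq] at heq
        obtain ⟨⟨rfl, rfl, rfl⟩, rfl⟩ := heq
        simp only [Mv, Nv] at m1 m2 z1 z2
        have pa1 : (a1:ℤ) ≠ 0 := by exact_mod_cast g1.1.ne_zero
        have pa2 : (a2:ℤ) ≠ 0 := by exact_mod_cast g2.1.ne_zero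
        have hu : (u1:ℤ) = u1' := mul_left_cancel₀ pa1 (by linarith)
        have hu' : u1 = u1' := by exact_mod_cast hu
        subst hu'
        have pu1 : (u1:ℤ) ≠ 0 := by have : 1 ≤ u1 := g1.2.2.2.2.2.1; omega
        have w1 := (mul_eq_zero.mp z1).resolve_left (mul_ne_zero pa1 pa2)
        have w2 := (mul_eq_zero.mp z2).resolve_left (mul_ne_zero pa1 pa2)
        have hb : (b2:ℤ) = b2' := mul_right_cancel₀ pu1 (by linarith)
        have hb' : b2 = b2' := by exact_mod_cast hb
        subst hb'
        rfl
    refine h1.trans ?_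
    rw [Finset.card_sigma]
    calc ∑ x ∈ T, (x.1 * x.2.2).divisors.card ≤ ∑ x ∈ T, Dv := by
          apply Finset.sum_le_sum
          intro x hx
          apply hD
          obtain ⟨_, _, ha, _, _, _, hu⟩ := hgood x hx
          have := Nat.mul_le_mul ha hu
          omega
      _ = T.card * Dv := by simp
      _ ≤ _ := Nat.mul_le_mul_right _ hcT
  have c2 : P2.card ≤ ((2 * (N*U) + 1) * N) * (Dv * Dv) := by
    have h1 : P2.card ≤ ((IM ×ˢ Finset.Icc 1 N).sigma (fun x => (Nf p k N U x.1).natAbs.divisors ×ˢ (Nf p k N U x.1).natAbs.divisors)).card := by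
      apply Finset.card_le_card_of_injOn (fun t => ⟨(Mv t, t.1.2.1), (t.1.1, t.2.1)⟩)
      · intro t ht
        have ht := Finset.mem_coe.mp ht
        rw [hP2, Finset.mem_filter] at ht
        obtain ⟨g1, g2, hf, _, hnz⟩ := hPg t ht.1
        have hm := hMI t ht.1
        have hnz := hnz ht.2.1
        simp only [Finset.coe_sigma, Set.mem_sigma_iff, Finset.mem_coe, Finset.mem_product, Nat.mem_divisors, hf]
        refine ⟨⟨hm, Finset.mem_Icc.mpr ⟨g1.2.2.2.1, g1.2.2.2.2.1⟩⟩, ⟨?_, by simpa using hnz⟩, ⟨?_, by simpa using hnz⟩⟩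
        · rw [← Int.natCast_dvd]; unfold Nv
          exact Dvd.dvd.mul_right (Dvd.intro _ rfl) _
        · rw [← Int.natCast_dvd]; unfold Nv
          exact Dvd.dvd.mul_right (Dvd.intro_left _ rfl) _
      · intro t ht t' ht' heq
        have ht := Finset.mem_coe.mp ht
        have ht' := Finset.mem_coe.mp ht'
        rw [hP2, Finset.mem_filter] at ht ht'
        obtain ⟨g1, g2, hf, hz, _⟩ := hPg t ht.1
        obtain ⟨g1', g2', hf', hz', _⟩ := hPg t' ht'.1
        have hne := ht.2.2
        simp only [Sigma.mk.injEq, Prod.mk.injEq] at heq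
        obtain ⟨⟨hM, hb⟩, hh⟩ := heq
        have hh := eq_of_heq hh
        rw [Prod.mk.injEq] at hh
        rw [hM, hf'] at hf
        obtain ⟨⟨a1, b1, u1⟩, ⟨a2, b2, u2⟩⟩ := t
        obtain ⟨⟨a1', b1', u1'⟩, ⟨a2', b2', u2'⟩⟩ := t'
        simp only at hh hb hne
        obtain ⟨rfl, rfl⟩ := hh
        subst hb
        simp only [Mv, Nv] at hM hf
        have pa1 : (a1:ℤ) ≠ 0 := by exact_mod_cast g1.1.ne_zero
        have pa2 : (a2:ℤ) ≠ 0 := by exact_mod_cast g2.1.ne_zero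
        have hu2 : u2 = u2' := by
          have hcop : IsCoprime (a1:ℤ) (a2:ℤ) := by
            rw [Nat.isCoprime_iff_coprime]
            exact (Nat.coprime_primes g1.1 g2.1).mpr hne
          have hdvd : (a1:ℤ) ∣ a2 * ((u2:ℤ) - u2') := ⟨(u1:ℤ) - u1', by linarith⟩
          have hdvd := hcop.dvd_of_dvd_mul_left hdvd
          have : (u2:ℤ) - u2' = 0 := by
            apply Int.eq_zero_of_abs_lt_dvd hdvd
            have q1 := g1.2.1
            have q2 : u2 ≤ U := g2.2.2.2.2.2.2
            have q3 : u2' ≤ U := g2'.2.2.2.2.2.2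
            simp only at q1
            rw [abs_lt]; constructor <;> omega
          omega
        subst hu2
        have hu : (u1:ℤ) = u1' := mul_left_cancel₀ pa1 (by linarith)
        have hu' : u1 = u1' := by exact_mod_cast hu
        subst hu'
        have pu1 : (u1:ℤ) ≠ 0 := by have : 1 ≤ u1 := g1.2.2.2.2.2.1; omega
        have w1 := mul_left_cancel₀ (mul_ne_zero pa1 pa2) hf
        have hb : (b2:ℤ) = b2' := mul_right_cancel₀ pu1 (by linarith)
        have hb' : b2 = b2' := by exact_mod_cast hb
        subst hb'
        rfl
    refine h1.trans ?_
    rw [Finset.card_sigma]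
    calc ∑ x ∈ IM ×ˢ Finset.Icc 1 N, ((Nf p k N U x.1).natAbs.divisors ×ˢ (Nf p k N U x.1).natAbs.divisors).card ≤ ∑ x ∈ IM ×ˢ Finset.Icc 1 N, Dv * Dv := by
          apply Finset.sum_le_sum
          intro x hx
          rw [Finset.card_product]
          exact Nat.mul_le_mul (hDN _) (hDN _)
      _ = _ := by rw [Finset.sum_const, Finset.card_product, hIMc]; simp
  have c3 : P3.card ≤ ((2 * (N*U) + 1) * N) * (Dv * Dv) := by
    have h1 : P3.card ≤ ((IM ×ˢ Finset.Icc 1 N).sigma (fun x => (Nf p k N U x.1).natAbs.divisors.sigma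
        (fun a => (Nf p k N U x.1 / ((a:ℤ) * a) - (x.1 / (a:ℤ)) * x.2).natAbs.divisors))).card := by
      apply Finset.card_le_card_of_injOn (fun t => ⟨(Mv t, t.1.2.1), ⟨t.1.1, t.1.2.2⟩⟩)
      · intro t ht
        have ht := Finset.mem_coe.mp ht
        rw [hP3, Finset.mem_filter] at ht
        obtain ⟨g1, g2, hf, _, hnz⟩ := hPg t ht.1
        have hm := hMI t ht.1
        have hnz := hnz ht.2.1
        have haa := ht.2.2.1
        have hbb := ht.2.2.2
        simp only [Finset.coe_sigma, Set.mem_sigma_iff, Finset.mem_coe, Finset.mem_product, Nat.mem_divisors, hf]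
        have pa1 : (t.1.1:ℤ) ≠ 0 := by exact_mod_cast g1.1.ne_zero
        have pu1 : (t.1.2.2:ℤ) ≠ 0 := by have : 1 ≤ t.1.2.2 := g1.2.2.2.2.2.1; omega
        have e1 : Nv t / ((t.1.1:ℤ) * t.1.1) = (t.1.2.1 : ℤ) * t.2.2.2 - (t.2.2.1 : ℤ) * t.1.2.2 := by
          unfold Nv; rw [← haa]; exact Int.mul_ediv_cancel_left _ (mul_ne_zero pa1 pa1)
        have e2 : Mv t / (t.1.1:ℤ) = (t.2.2.2 : ℤ) - t.1.2.2 := by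
          unfold Mv; rw [← haa, ← mul_sub]; exact Int.mul_ediv_cancel_left _ pa1
        have e3 : Nv t / ((t.1.1:ℤ) * t.1.1) - Mv t / (t.1.1:ℤ) * t.1.2.1 = t.1.2.2 * ((t.1.2.1:ℤ) - t.2.2.1) := by
          rw [e1, e2]; ring
        rw [e3]
        refine ⟨⟨hm, Finset.mem_Icc.mpr ⟨g1.2.2.2.1, g1.2.2.2.2.1⟩⟩, ⟨?_, by simpa using hnz⟩, ⟨?_, ?_⟩⟩
        · rw [← Int.natCast_dvd]; unfold Nv
          exact Dvd.dvd.mul_right (Dvd.intro _ rfl) _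
        · rw [← Int.natCast_dvd]; exact Dvd.intro _ rfl
        · rw [Int.natAbs_ne_zero]
          apply mul_ne_zero pu1
          intro h; apply hbb; omega
      · intro t ht t' ht' heq
        have ht := Finset.mem_coe.mp ht
        have ht' := Finset.mem_coe.mp ht'
        rw [hP3, Finset.mem_filter] at ht ht'
        obtain ⟨g1, g2, hf, hz, _⟩ := hPg t ht.1
        obtain ⟨g1', g2', hf', hz', _⟩ := hPg t' ht'.1
        have haa := ht.2.2.1
        have haa' := ht'.2.2.1
        simp only [Sigma.mk.injEq, Prod.mk.injEq] at heq
        obtain ⟨⟨hM, hb⟩, hh⟩ := heq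
        have hh := eq_of_heq hh
        simp only [Sigma.mk.injEq, heq_eq_eq] at hh
        rw [hM, hf'] at hf
        obtain ⟨⟨a1, b1, u1⟩, ⟨a2, b2, u2⟩⟩ := t
        obtain ⟨⟨a1', b1', u1'⟩, ⟨a2', b2', u2'⟩⟩ := t'
        simp only at hh hb haa haa'
        obtain ⟨rfl, rfl⟩ := hh
        subst hb haa haa'
        simp only [Mv, Nv] at hM hf
        have pa1 : (a1:ℤ) ≠ 0 := by exact_mod_cast g1.1.ne_zero
        have hu2 : u2 = u2' := by
          have : (u2:ℤ) = u2' := mul_left_cancel₀ pa1 (by linarith)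
          exact_mod_cast this
        subst hu2
        have pu1 : (u1:ℤ) ≠ 0 := by have : 1 ≤ u1 := g1.2.2.2.2.2.1; omega
        have w1 := mul_left_cancel₀ (mul_ne_zero pa1 pa1) hf
        have hb : (b2:ℤ) = b2' := mul_right_cancel₀ pu1 (by linarith)
        have hb' : b2 = b2' := by exact_mod_cast hb
        subst hb'
        rfl
    refine h1.trans ?_
    rw [Finset.card_sigma]
    calc _ ≤ ∑ x ∈ IM ×ˢ Finset.Icc 1 N, Dv * Dv := by
          apply Finset.sum_le_sum
          intro x hx
          rw [Finset.card_sigma]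
          refine (Finset.sum_le_card_nsmul _ _ Dv ?_).trans ?_
          · intro a ha
            apply hD
            rw [Finset.mem_product, hIM, Finset.mem_Icc, Finset.mem_Icc] at hx
            have q1 : |Nf p k N U x.1 / ((a:ℤ) * a)| ≤ N ^ 3 * U := by
              refine le_trans ?_ (Nf_abs k N U x.1)
              exact Int.abs_ediv_le_abs _ _
            have q2 : |x.1 / (a:ℤ)| ≤ N * U := by
              refine le_trans (Int.abs_ediv_le_abs _ _) ?_
              rw [abs_le]; exact_mod_cast hx.1
            have q3 : |x.1 / (a:ℤ) * (x.2:ℤ)| ≤ N ^ 3 * U := by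
              rw [abs_mul]
              have : |(x.2:ℤ)| ≤ N := by
                rw [abs_of_nonneg (by positivity)]; exact_mod_cast hx.2.2
              calc _ ≤ ((N:ℤ) * U) * N := by gcongr
                _ = ((N ^ 2 * U : ℕ) : ℤ) := by push_cast; ring
                _ ≤ ((N ^ 3 * U : ℕ) : ℤ) := by exact_mod_cast hN23
                _ = _ := by push_cast; ring
            have q4 := abs_sub (Nf p k N U x.1 / ((a:ℤ) * a)) (x.1 / (a:ℤ) * (x.2:ℤ))
            have hz : (2 * ((N:ℤ) ^ 3 * U)) < p := by exact_mod_cast hsz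
            zify
            linarith
          · rw [smul_eq_mul]; exact Nat.mul_le_mul_right _ (hDN _)
      _ = _ := by rw [Finset.sum_const, Finset.card_product, hIMc]; simp
  have c4 : P4.card ≤ ((2 * (N*U) + 1) * U) * Dv := by
    have h1 : P4.card ≤ ((IM ×ˢ Finset.Icc 1 U).sigma (fun x => (Nf p k N U x.1).natAbs.divisors)).card := by
      apply Finset.card_le_card_of_injOn (fun t => ⟨(Mv t, t.1.2.2), t.1.1⟩)
      · intro t ht
        have ht := Finset.mem_coe.mp ht
        rw [hP4, Finset.mem_filter] at ht
        obtain ⟨g1, g2, hf, _, hnz⟩ := hPg t ht.1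
        have hm := hMI t ht.1
        have hnz := hnz ht.2.1
        simp only [Finset.coe_sigma, Set.mem_sigma_iff, Finset.mem_coe, Finset.mem_product, Nat.mem_divisors, hf]
        refine ⟨⟨hm, Finset.mem_Icc.mpr ⟨g1.2.2.2.2.2.1, g1.2.2.2.2.2.2⟩⟩, ⟨?_, by simpa using hnz⟩⟩
        rw [← Int.natCast_dvd]; unfold Nv
        exact Dvd.dvd.mul_right (Dvd.intro _ rfl) _
      · intro t ht t' ht' heq
        have ht := Finset.mem_coe.mp ht
        have ht' := Finset.mem_coe.mp ht'
        rw [hP4, Finset.mem_filter] at ht ht'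
        obtain ⟨g1, g2, hf, hz, _⟩ := hPg t ht.1
        obtain ⟨g1', g2', hf', hz', _⟩ := hPg t' ht'.1
        have haa := ht.2.2.1
        have haa' := ht'.2.2.1
        have hbb := ht.2.2.2
        have hbb' := ht'.2.2.2
        have hM0 := ht.2.1
        simp only [Sigma.mk.injEq, Prod.mk.injEq, heq_eq_eq] at heq
        obtain ⟨⟨hM, hb⟩, hh⟩ := heq
        rw [hM, hf'] at hf
        obtain ⟨⟨a1, b1, u1⟩, ⟨a2, b2, u2⟩⟩ := t
        obtain ⟨⟨a1', b1', u1'⟩, ⟨a2', b2', u2'⟩⟩ := t'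
        simp only at hh hb haa haa' hbb hbb'
        subst hh hb haa haa' hbb hbb'
        simp only [Mv, Nv] at hM hf hM0
        have pa1 : (a1:ℤ) ≠ 0 := by exact_mod_cast g1.1.ne_zero
        have hu2 : u2 = u2' := by
          have : (u2:ℤ) = u2' := mul_left_cancel₀ pa1 (by linarith)
          exact_mod_cast this
        subst hu2
        have w1 := mul_left_cancel₀ (mul_ne_zero pa1 pa1) hf
        have hne : ((u2:ℤ) - u1) ≠ 0 := by
          intro h; apply hM0; rw [← mul_sub, h, mul_zero]
        have hb : (b1:ℤ) = b1' := mul_right_cancel₀ hne (by linarith)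
        have hb' : b1 = b1' := by exact_mod_cast hb
        subst hb'
        rfl
    refine h1.trans ?_
    rw [Finset.card_sigma]
    calc _ ≤ ∑ x ∈ IM ×ˢ Finset.Icc 1 U, Dv := by
          apply Finset.sum_le_sum
          intro x hx
          exact hDN _
      _ = _ := by rw [Finset.sum_const, Finset.card_product, hIMc]; simp
  have htot : P.card ≤ P1.card + (P2.card + (P3.card + P4.card)) :=
    (Finset.card_le_card hcover).trans ((Finset.card_union_le _ _).trans (Nat.add_le_add_left
      ((Finset.card_union_le _ _).trans (Nat.add_le_add_left (Finset.card_union_le _ _) _)) _))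
  have hNU1 : 2 * (N * U) + 1 ≤ 3 * (N * U) := by
    have : 1 ≤ N * U := by nlinarith
    omega
  have hDD : Dv ≤ Dv * Dv := by nlinarith
  have d1 : (N * N * U) * Dv ≤ (N ^ 2 * U) * (Dv^2) := by
    calc (N * N * U) * Dv ≤ (N * N * U) * (Dv * Dv) := Nat.mul_le_mul_left _ hDD
      _ = _ := by ring
  have d2 : ((2 * (N*U) + 1) * N) * (Dv * Dv) ≤ 3 * ((N ^ 2 * U) * (Dv^2)) := by
    calc ((2 * (N*U) + 1) * N) * (Dv * Dv) ≤ ((3 * (N * U)) * N) * (Dv * Dv) := by gcongr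
      _ = _ := by ring
  have d4 : ((2 * (N*U) + 1) * U) * Dv ≤ 3 * ((N ^ 2 * U) * (Dv^2)) := by
    calc ((2 * (N*U) + 1) * U) * Dv ≤ ((3 * (N * U)) * N) * (Dv * Dv) := by gcongr
      _ = _ := by ring
  omega

end Stp
end

section
namespace Stp
variable {p : ℕ} [Fact p.Prime]

lemma shift_bound (F : ℕ → ℝ) (hF : ∀ n, |F n| ≤ 1) (N h : ℕ) :
    |∑ b ∈ Finset.Icc 1 N, F (b + h) - ∑ b ∈ Finset.Icc 1 N, F b| ≤ 2 * h := by
  induction h with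
  | zero => simp
  | succ h ih =>
    have h1 : ∑ b ∈ Finset.Icc 1 N, F (b + (h+1)) - ∑ b ∈ Finset.Icc 1 N, F (b + h) = F (N + 1 + h) - F (1 + h) := by
      rw [← Finset.sum_sub_distrib]
      clear ih
      induction N with
      | zero => simp
      | succ N ihN =>
        rw [Finset.sum_Icc_succ_top (by omega), ihN]
        have e1 : N + 1 + (h + 1) = N + 1 + 1 + h := by omega
        rw [e1]; ring
    have h2 : |F (N + 1 + h) - F (1 + h)| ≤ 2 := by
      have := abs_sub (F (N + 1 + h)) (F (1 + h))
      have := hF (N+1+h)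
      have := hF (1+h)
      linarith
    rw [← h1] at h2
    have h3 := abs_add_le (∑ b ∈ Finset.Icc 1 N, F (b + (h+1)) - ∑ b ∈ Finset.Icc 1 N, F (b + h)) (∑ b ∈ Finset.Icc 1 N, F (b + h) - ∑ b ∈ Finset.Icc 1 N, F b)
    rw [sub_add_sub_cancel] at h3
    push_cast
    linarith

lemma holder {τ : Type*} (T : Finset τ) (g : τ → ZMod p) (w : ZMod p → ℝ) (hw : ∀ x, 0 ≤ w x) (n : ℕ)
    (E : ℝ) (hE : (((T ×ˢ T).filter (fun t => g t.1 = g t.2)).card : ℝ) ≤ E) :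
    (∑ t ∈ T, w (g t)) ^ (2 * (n + 1)) ≤ (T.card : ℝ) ^ (2 * n) * (E * ∑ x : ZMod p, w x ^ (2 * (n + 1))) := by
  classical
  rcases Finset.eq_empty_or_nonempty T with hT | hT
  · subst hT
    simp at hE ⊢
    have : 0 ≤ ∑ x : ZMod p, w x ^ (2 * (n + 1)) := Finset.sum_nonneg (fun x _ => pow_nonneg (hw x) _)
    positivity
  have hc : (0:ℝ) < T.card := by exact_mod_cast hT.card_pos
  have h1 : (∑ t ∈ T, w (g t)) ^ (n+1) ≤ (T.card : ℝ) ^ n * ∑ t ∈ T, w (g t) ^ (n+1) := by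
    have := pow_sum_div_card_le_sum_pow (s := T) (f := fun t => w (g t)) (fun t _ => hw _) n
    rw [div_le_iff₀ (by positivity)] at this
    linarith
  set ν : ZMod p → ℝ := fun x => ((T.filter (fun t => g t = x)).card : ℝ) with hν
  have h2 : ∑ t ∈ T, w (g t) ^ (n+1) = ∑ x : ZMod p, ν x * w x ^ (n+1) := by
    rw [← Finset.sum_fiberwise T g]
    apply Finset.sum_congr rfl
    intro x _
    rw [Finset.sum_congr rfl (g := fun _ => w x ^ (n+1))]
    · simp [hν]
    · intro t ht; rw [(Finset.mem_filter.mp ht).2]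
  have h3 : (∑ x : ZMod p, ν x * w x ^ (n+1)) ^ 2 ≤ (∑ x : ZMod p, ν x ^ 2) * ∑ x : ZMod p, (w x ^ (n+1)) ^ 2 :=
    Finset.sum_mul_sq_le_sq_mul_sq _ _ _
  have h4 : ∑ x : ZMod p, ν x ^ 2 = (((T ×ˢ T).filter (fun t => g t.1 = g t.2)).card : ℝ) := by
    rw [Finset.card_eq_sum_card_fiberwise (f := fun t => g t.1) (t := Finset.univ) (by intro x _; simp)]
    push_cast
    apply Finset.sum_congr rfl
    intro x _
    rw [hν, pow_two]
    dsimp only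
    rw [← Nat.cast_mul, ← Finset.card_product]
    congr 2
    ext t
    simp only [Finset.mem_product, Finset.mem_filter]
    constructor
    · rintro ⟨⟨a, b⟩, c, d⟩; exact ⟨⟨⟨a, c⟩, by rw [b, d]⟩, b⟩
    · rintro ⟨⟨⟨a, c⟩, b⟩, d⟩; exact ⟨⟨a, d⟩, c, by rw [← b, d]⟩
  have h0 : 0 ≤ ∑ t ∈ T, w (g t) := Finset.sum_nonneg (fun t _ => hw _)
  have h5 : ∑ x : ZMod p, (w x ^ (n+1)) ^ 2 = ∑ x : ZMod p, w x ^ (2 * (n + 1)) := by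
    apply Finset.sum_congr rfl
    intro x _
    rw [← pow_mul, mul_comm]
  have h6 : 0 ≤ ∑ x : ZMod p, w x ^ (2 * (n + 1)) := Finset.sum_nonneg (fun x _ => pow_nonneg (hw x) _)
  calc (∑ t ∈ T, w (g t)) ^ (2 * (n + 1)) = ((∑ t ∈ T, w (g t)) ^ (n+1)) ^ 2 := by rw [← pow_mul, mul_comm]
    _ ≤ ((T.card : ℝ) ^ n * ∑ t ∈ T, w (g t) ^ (n+1)) ^ 2 := pow_le_pow_left₀ (by positivity) h1 2
    _ = (T.card : ℝ) ^ (2 * n) * (∑ x : ZMod p, ν x * w x ^ (n+1)) ^ 2 := by rw [h2]; ring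
    _ ≤ (T.card : ℝ) ^ (2 * n) * (E * ∑ x : ZMod p, w x ^ (2 * (n + 1))) := by
      rw [h4, h5] at h3
      gcongr
      exact h3.trans (by gcongr)

lemma burgess (hp2 : p ≠ 2) (k : ZMod p) (hk : k ≠ 0) (N U V Dv n : ℕ) (hU : 1 ≤ U) (hUN : U ≤ N) (hD1 : 1 ≤ Dv)
    (hVp : V < p) (hsz : 2 * (N ^ 3 * U) < p)
    (hD : ∀ n : ℕ, n < p → n.divisors.card ≤ Dv)
    (A : Finset ℕ) (hA : ∀ a ∈ A, a.Prime ∧ U < a ∧ a ≤ N) (S X : ℝ) (hX0 : 0 ≤ X) (hX : X ≤ S - 2 * (U * V))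
    (hS : ∀ a ∈ A, ∑ b ∈ Finset.Icc 1 N, chi p ((b : ZMod p) - k * (a : ZMod p)⁻¹) = - S) :
    ((A.card : ℝ) * U * V * X) ^ (2 * (n + 1)) ≤ ((A.card : ℝ) * N * U) ^ (2 * n) *
      (10 * ((N:ℝ) ^ 2 * U * (Dv:ℝ) ^ 2) * (((n+1 : ℕ):ℝ) ^ (2*(n+1)) * (V:ℝ) ^ (n+1) * p + 100 * (n+1 : ℕ) * (V:ℝ) ^ (2*(n+1)) * √p)) := by
  classical
  set T := A ×ˢ Finset.Icc 1 N ×ˢ Finset.Icc 1 U with hT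
  set W : ZMod p → ℝ := fun x => ∑ v ∈ Finset.Icc 1 V, chi p (x + (v : ZMod p)) with hW
  set g : ℕ × ℕ × ℕ → ZMod p := fun t => ((t.2.1 : ZMod p) - k * (t.1 : ZMod p)⁻¹) * (t.2.2 : ZMod p)⁻¹ with hg
  have hNp : N < p := by
    have hN1 : 1 ≤ N := by omega
    have h1 : N ^ 1 * 1 ≤ N ^ 3 * U := Nat.mul_le_mul (Nat.pow_le_pow_right hN1 (by norm_num)) hU
    rw [pow_one, mul_one] at h1
    omega
  have hmain : (A.card : ℝ) * U * V * X ≤ ∑ t ∈ T, |W (g t)| := by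
    rw [hT, Finset.sum_product]
    have : ∀ a ∈ A, (U:ℝ) * V * X ≤ ∑ y ∈ Finset.Icc 1 N ×ˢ Finset.Icc 1 U, |W (g (a, y))| := by
      intro a ha
      rw [Finset.sum_product_right]
      have : ∀ u ∈ Finset.Icc 1 U, (V:ℝ) * X ≤ ∑ b ∈ Finset.Icc 1 N, |W (g (a, b, u))| := by
        intro u hu
        rw [Finset.mem_Icc] at hu
        have hu0 : (u : ZMod p) ≠ 0 := by
          rw [Ne, ZMod.natCast_eq_zero_iff]
          intro h
          have := Nat.le_of_dvd (by omega) h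
          omega
        have e1 : ∀ v ∈ Finset.Icc 1 V, X ≤ - ∑ b ∈ Finset.Icc 1 N, chi p ((b : ZMod p) + (u * v : ℕ) - k * (a : ZMod p)⁻¹) := by
          intro v hv
          rw [Finset.mem_Icc] at hv
          have := shift_bound (fun m => chi p ((m : ZMod p) - k * (a : ZMod p)⁻¹)) (fun m => chi_abs_le _) N (u * v)
          rw [hS a ha] at this
          have h2 := (abs_le.mp this).2
          have h3 : ((u * v : ℕ) : ℝ) ≤ U * V := by
            exact_mod_cast Nat.mul_le_mul hu.2 hv.2
          push_cast at h2 h3 ⊢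
          linarith
        have e2 := Finset.card_nsmul_le_sum _ _ _ e1
        rw [Finset.sum_neg_distrib, Finset.sum_comm] at e2
        simp only [Nat.card_Icc, Nat.add_sub_cancel, nsmul_eq_mul] at e2
        refine e2.trans ?_
        rw [← Finset.sum_neg_distrib]
        apply Finset.sum_le_sum
        intro b _
        have e3 : ∑ v ∈ Finset.Icc 1 V, chi p ((b : ZMod p) + (u * v : ℕ) - k * (a : ZMod p)⁻¹) = chi p u * W (g (a, b, u)) := by
          rw [hW, hg]
          dsimp only
          rw [Finset.mul_sum]
          apply Finset.sum_congr rfl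
          intro v _
          rw [← chi_mul]
          congr 1
          push_cast
          field_simp
          try ring
        rw [e3]
        refine (neg_le_abs _).trans ?_
        rw [abs_mul]
        exact mul_le_of_le_one_left (abs_nonneg _) (chi_abs_le _)
      have e4 := Finset.card_nsmul_le_sum _ _ _ this
      simp only [Nat.card_Icc, Nat.add_sub_cancel, nsmul_eq_mul] at e4
      linarith
    have e5 := Finset.card_nsmul_le_sum _ _ _ this
    rw [nsmul_eq_mul] at e5
    linarith
  have hcount := count k hk N U Dv hU hUN hD1 hsz hD A hA
  have hh := holder T g (fun x => |W x|) (fun x => abs_nonneg _) n (10 * ((N:ℝ) ^ 2 * U * (Dv:ℝ) ^ 2)) (by exact_mod_cast hcount)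
  have hTc : (T.card : ℝ) = (A.card : ℝ) * N * U := by
    rw [hT, Finset.card_product, Finset.card_product]; simp [mul_assoc]
  have hmom := moment hp2 (n+1) V (by omega) hVp
  have habs : ∑ x : ZMod p, |W x| ^ (2 * (n+1)) = ∑ x : ZMod p, (∑ v ∈ Finset.Icc 1 V, chi p (x + (v : ZMod p))) ^ (2 * (n+1)) := by
    apply Finset.sum_congr rfl
    intro x _
    rw [Even.pow_abs ⟨n+1, by ring⟩]
  rw [habs, hTc] at hh
  calc _ ≤ (∑ t ∈ T, |W (g t)|) ^ (2 * (n+1)) := pow_le_pow_left₀ (by positivity) hmain _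
    _ ≤ _ := hh
    _ ≤ _ := by gcongr

end Stp
end

section
namespace Stp

lemma divisor_bound (κ : ℝ) (hκ : 0 < κ) : ∃ C : ℝ, 1 ≤ C ∧ ∀ n : ℕ, n ≠ 0 → (n.divisors.card : ℝ) ≤ C * (n:ℝ) ^ κ := by
  -- threshold
  obtain ⟨B, hB⟩ : ∃ B : ℕ, ∀ q : ℕ, B ≤ q → (2:ℝ) ≤ (q:ℝ) ^ κ := by
    obtain ⟨B, hB⟩ := exists_nat_gt ((2:ℝ) ^ (1/κ))
    refine ⟨B, fun q hq => ?_⟩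
    have h1 : (2:ℝ) ^ (1/κ) ≤ q := hB.le.trans (by exact_mod_cast hq)
    have h2 := Real.rpow_le_rpow (by positivity) h1 hκ.le
    rwa [← Real.rpow_mul (by norm_num), one_div, inv_mul_cancel₀ hκ.ne', Real.rpow_one] at h2
  set c : ℝ := 1 + 1 / (κ * Real.log 2) with hc
  have hl2 : 0 < Real.log 2 := Real.log_pos (by norm_num)
  have hc1 : 1 ≤ c := by rw [hc]; have : 0 < 1 / (κ * Real.log 2) := by positivity
                         linarith
  have hsmall : ∀ q e : ℕ, 2 ≤ q → ((e:ℝ) + 1) ≤ c * ((q:ℝ) ^ e) ^ κ := by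
    intro q e hq
    have h2 : (2:ℝ) ≤ q := by exact_mod_cast hq
    have h3 : ((2:ℝ) ^ e) ^ κ ≤ ((q:ℝ) ^ e) ^ κ := by gcongr
    have h4 : 1 + κ * Real.log 2 * e ≤ ((2:ℝ) ^ e) ^ κ := by
      rw [← Real.rpow_natCast, ← Real.rpow_mul (by norm_num), Real.rpow_def_of_pos (by norm_num)]
      have := Real.add_one_le_exp (Real.log 2 * (e * κ))
      linarith
    have h5 : ((e:ℝ) + 1) ≤ c * (1 + κ * Real.log 2 * e) := by
      have h6 : c * (1 + κ * Real.log 2 * e) = 1 + κ * Real.log 2 * e + 1 / (κ * Real.log 2) + e := by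
        rw [hc]; field_simp; ring
      rw [h6]
      have : 0 < 1 / (κ * Real.log 2) := by positivity
      have : 0 ≤ κ * Real.log 2 * e := by positivity
      linarith
    calc _ ≤ _ := h5
      _ ≤ c * ((q:ℝ) ^ e) ^ κ := by gcongr; exact h4.trans h3
  have hbig : ∀ q e : ℕ, B ≤ q → ((e:ℝ) + 1) ≤ ((q:ℝ) ^ e) ^ κ := by
    intro q e hq
    have h1 : ((q:ℝ) ^ e) ^ κ = ((q:ℝ) ^ κ) ^ e := by
      rw [← Real.rpow_natCast, ← Real.rpow_natCast, ← Real.rpow_mul (by positivity), ← Real.rpow_mul (by positivity), mul_comm]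
    rw [h1]
    have h2 : (2:ℝ) ^ e ≤ ((q:ℝ) ^ κ) ^ e := pow_le_pow_left₀ (by norm_num) (hB q hq) e
    have h3 : e + 1 ≤ 2 ^ e := Nat.lt_two_pow_self
    have h4 : (e:ℝ) + 1 ≤ 2 ^ e := by exact_mod_cast h3
    linarith
  refine ⟨c ^ B, one_le_pow₀ hc1, fun n hn => ?_⟩
  rw [Nat.card_divisors hn]
  have hprod : (n:ℝ) ^ κ = ∏ q ∈ n.primeFactors, ((q:ℝ) ^ (n.factorization q)) ^ κ := by
    rw [Real.finsetProd_rpow _ _ (fun i _ => by positivity)]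
    congr 1
    conv_lhs => rw [← Nat.prod_factorization_pow_eq_self hn]
    rw [Finsupp.prod]
    push_cast
    rfl
  rw [hprod]
  push_cast
  calc ∏ q ∈ n.primeFactors, ((n.factorization q : ℝ) + 1) ≤ ∏ q ∈ n.primeFactors, ((if q < B then c else 1) * ((q:ℝ) ^ (n.factorization q)) ^ κ) := by
        apply Finset.prod_le_prod
        · intros; positivity
        · intro q hq
          split_ifs with h
          · exact hsmall _ _ (Nat.prime_of_mem_primeFactors hq).two_le
          · rw [one_mul]; exact hbig _ _ (by omega)
    _ = (∏ q ∈ n.primeFactors, (if q < B then c else 1)) * ∏ q ∈ n.primeFactors, ((q:ℝ) ^ (n.factorization q)) ^ κ := Finset.prod_mul_distrib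
    _ ≤ _ := by
      gcongr
      rw [← Finset.prod_filter, Finset.prod_const]
      apply pow_le_pow_right₀ hc1
      calc _ ≤ (Finset.range B).card := Finset.card_le_card (fun q hq => by simp at hq ⊢; exact hq.2)
        _ = B := by simp

end Stp
end

section
namespace Stp
open Finset

/-- primes up to `N` -/
def prs (N : ℕ) : Finset ℕ := (Icc 1 N).filter Nat.Prime

/-- Mertens sum -/
noncomputable def MM (N : ℕ) : ℝ := ∑ q ∈ prs N, Real.log q / q

lemma mem_prs {N q : ℕ} : q ∈ prs N ↔ q.Prime ∧ q ≤ N := by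
  simp only [prs, mem_filter, mem_Icc]
  constructor
  · rintro ⟨⟨_, h⟩, h'⟩; exact ⟨h', h⟩
  · rintro ⟨h, h'⟩; exact ⟨⟨h.one_lt.le, h'⟩, h⟩

lemma log_fact (N : ℕ) : Real.log (N.factorial) = ∑ q ∈ prs N, (N.factorial.factorization q : ℝ) * Real.log q := by
  have h0 := Nat.factorial_ne_zero N
  conv_lhs => rw [← Nat.prod_factorization_pow_eq_self h0]
  rw [Finsupp.prod, Nat.cast_prod, Real.log_prod]
  · have hs : N.factorial.factorization.support = prs N := by
      ext q
      rw [Nat.support_factorization, Nat.mem_primeFactors, mem_prs]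
      constructor
      · rintro ⟨h, h1, _⟩; exact ⟨h, h.dvd_factorial.mp h1⟩
      · rintro ⟨h, h1⟩; exact ⟨h, h.dvd_factorial.mpr h1, h0⟩
    rw [hs]
    apply sum_congr rfl
    intro q _
    push_cast
    rw [Real.log_pow]
  · intro q hq
    rw [Nat.support_factorization, Nat.mem_primeFactors] at hq
    have := hq.1.pos
    positivity

lemma fact_val_ge (N q : ℕ) (hq : q.Prime) : (N:ℝ) / q - 1 ≤ (N.factorial.factorization q : ℝ) := by
  have h1 : q ^ (N / q) ∣ N.factorial := by
    have h2 : q ^ (N/q) ∣ (q * (N/q)).factorial := by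
      generalize N / q = m
      induction m with
      | zero => simp
      | succ m ih =>
        rw [pow_succ]
        have h3 : q * (m+1) = (q * m + (q - 1)) + 1 := by
          have := hq.pos
          rw [mul_add]; omega
        rw [h3, Nat.factorial_succ, ← h3, mul_comm]
        apply Nat.mul_dvd_mul (Dvd.intro _ rfl)
        exact ih.trans (Nat.factorial_dvd_factorial (by omega))
    exact h2.trans (Nat.factorial_dvd_factorial (Nat.mul_div_le N q))
  have h4 := (hq.pow_dvd_iff_le_factorization (Nat.factorial_ne_zero N)).mp h1
  have h5 : ((N / q : ℕ) : ℝ) ≤ (N.factorial.factorization q : ℝ) := by exact_mod_cast h4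
  have h6 : (N:ℝ) / q < ((N/q : ℕ):ℝ) + 1 := by
    rw [div_lt_iff₀ (by exact_mod_cast hq.pos)]
    have := Nat.lt_mul_div_succ N hq.pos
    have : (N:ℝ) < q * ((N/q : ℕ) + 1) := by exact_mod_cast this
    linarith
  linarith

lemma fact_val_le (N q : ℕ) (hq : q.Prime) : (N.factorial.factorization q : ℝ) ≤ (N:ℝ) / (q - 1) := by
  have := Fact.mk hq
  have h1 := sub_one_mul_padicValNat_factorial (p := q) N
  have h2 : (q - 1) * padicValNat q N.factorial ≤ N := by omega
  have h3 : (1:ℝ) < q := by exact_mod_cast hq.one_lt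
  rw [le_div_iff₀ (by linarith), Nat.factorization_def _ hq]
  have h4 : (((q - 1) * padicValNat q N.factorial : ℕ):ℝ) ≤ N := by exact_mod_cast h2
  rw [Nat.cast_mul, Nat.cast_sub hq.one_lt.le] at h4
  push_cast at h4
  linarith

lemma MM_upper (N : ℕ) (hN : 1 ≤ N) : MM N ≤ Real.log N + Real.log 4 := by
  have hN' : (0:ℝ) < N := by exact_mod_cast hN
  have h1 : Real.log (N.factorial) ≤ N * Real.log N := by
    rw [← Real.log_pow]
    apply Real.log_le_log (by exact_mod_cast Nat.factorial_pos N)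
    exact_mod_cast Nat.factorial_le_pow N
  have h2 : ∑ q ∈ prs N, ((N:ℝ) / q - 1) * Real.log q ≤ Real.log (N.factorial) := by
    rw [log_fact]
    apply sum_le_sum
    intro q hq
    rw [mem_prs] at hq
    apply mul_le_mul_of_nonneg_right (fact_val_ge N q hq.1)
    exact Real.log_nonneg (by exact_mod_cast hq.1.one_lt.le)
  have h3 : ∑ q ∈ prs N, ((N:ℝ) / q - 1) * Real.log q = N * MM N - ∑ q ∈ prs N, Real.log q := by
    rw [MM, mul_sum, ← sum_sub_distrib]
    apply sum_congr rfl
    intro q _; ring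
  have h4 : ∑ q ∈ prs N, Real.log q ≤ Real.log 4 * N := by
    have := Chebyshev.theta_le_log4_mul_x (x := N) (by positivity)
    rw [Chebyshev.theta_eq_sum_primesLE_log] at this
    refine le_trans (le_of_eq ?_) this
    apply sum_congr _ (fun _ _ => rfl)
    ext q; rw [mem_prs, Nat.mem_primesLE]; tauto
  have h5 : N * MM N ≤ N * (Real.log N + Real.log 4) := by linarith
  exact le_of_mul_le_mul_left h5 hN'

lemma MM_lower : ∃ C : ℝ, 0 ≤ C ∧ ∀ N : ℕ, 1 ≤ N → Real.log N - C ≤ MM N := by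
  have hs : Summable (fun n : ℕ => 4 * (1 / (n:ℝ) ^ (3/2 : ℝ))) := by
    apply Summable.mul_left
    rw [Real.summable_one_div_nat_rpow]; norm_num
  refine ⟨1 + ∑' n : ℕ, 4 * (1 / (n:ℝ) ^ (3/2 : ℝ)), ?_, fun N hN => ?_⟩
  · have : 0 ≤ ∑' n : ℕ, 4 * (1 / (n:ℝ) ^ (3/2 : ℝ)) := tsum_nonneg (fun n => by positivity)
    linarith
  have hN' : (0:ℝ) < N := by exact_mod_cast hN
  have h1 : N * Real.log N - N ≤ Real.log (N.factorial) := by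
    have h := Real.pow_div_factorial_le_exp (N:ℝ) hN'.le N
    have h' := Real.log_le_log (by positivity) h
    rw [Real.log_exp, Real.log_div (by positivity) (by positivity), Real.log_pow] at h'
    linarith
  have h2 : Real.log (N.factorial) ≤ ∑ q ∈ prs N, N * (Real.log q / q + 4 * (1 / (q:ℝ) ^ (3/2 : ℝ))) := by
    rw [log_fact]
    apply sum_le_sum
    intro q hq
    rw [mem_prs] at hq
    have hq2 : (2:ℝ) ≤ q := by exact_mod_cast hq.1.two_le
    have hlog : 0 ≤ Real.log q := Real.log_nonneg (by linarith)
    refine (mul_le_mul_of_nonneg_right (fact_val_le N q hq.1) hlog).trans ?_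
    rw [div_mul_eq_mul_div, mul_div_assoc]
    apply mul_le_mul_of_nonneg_left _ hN'.le
    have e1 : Real.log q ≤ 2 * √q := by
      have := Real.log_le_sub_one_of_pos (x := √q) (by positivity)
      rw [Real.log_sqrt (by linarith)] at this
      linarith
    have e2 : (q:ℝ) ^ (3/2 : ℝ) = q * √q := by
      rw [Real.sqrt_eq_rpow, show (3/2:ℝ) = 1 + 1/2 by norm_num, Real.rpow_add (by linarith), Real.rpow_one]
    rw [e2]
    have e3 : Real.log q / (q - 1) - Real.log q / q = Real.log q / (q * (q-1)) := by
      have : (q:ℝ) - 1 ≠ 0 := by linarith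
      field_simp
      ring
    have e4 : Real.log q / (q * (q-1)) ≤ 4 * (1 / (q * √q)) := by
      have hsq : √(q:ℝ) * √q = q := Real.mul_self_sqrt (by linarith)
      have hs0 : 0 < √(q:ℝ) := Real.sqrt_pos.mpr (by linarith)
      have h1 : (0:ℝ) < q - 1 := by linarith
      rw [← mul_div_assoc, mul_one, div_le_div_iff₀ (by positivity) (by positivity)]
      calc Real.log q * (q * √q) ≤ (2 * √q) * (q * √q) := by gcongr
        _ = 2 * q * q := by rw [show 2 * √(q:ℝ) * (q * √q) = 2 * q * (√q * √q) by ring, hsq]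
        _ ≤ 4 * (q * (q - 1)) := by nlinarith
    linarith
  rw [← mul_sum, sum_add_distrib] at h2
  have h3 : ∑ q ∈ prs N, 4 * (1 / (q:ℝ) ^ (3/2 : ℝ)) ≤ ∑' n : ℕ, 4 * (1 / (n:ℝ) ^ (3/2 : ℝ)) :=
    hs.sum_le_tsum _ (fun n _ => by positivity)
  have h4 : (N:ℝ) * (Real.log N - 1) ≤ N * (∑ q ∈ prs N, Real.log q / q + ∑ q ∈ prs N, 4 * (1 / (q:ℝ) ^ (3/2 : ℝ))) := by linarith
  have h5 := le_of_mul_le_mul_left h4 hN'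
  rw [MM]; linarith

/-- Mertens on real intervals -/
lemma mertens_int : ∃ C : ℝ, 0 ≤ C ∧ ∀ x y : ℝ, 1 < y → y ≤ x →
    ∑ q ∈ (prs ⌊x⌋₊).filter (fun q : ℕ => y < q), (1:ℝ) / q ≤ (Real.log x - Real.log y + C) / Real.log y := by
  obtain ⟨C, hC, h⟩ := MM_lower
  refine ⟨C + Real.log 4 + Real.log 2, by positivity, fun x y hy hxy => ?_⟩
  have hly : 0 < Real.log y := Real.log_pos hy
  rw [le_div_iff₀ hly]
  have hfy : 1 ≤ ⌊y⌋₊ := Nat.le_floor (by simpa using hy.le)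
  have hfx : 1 ≤ ⌊x⌋₊ := Nat.le_floor (by simpa using (hy.le.trans hxy))
  have h1 := h _ hfy
  have h2 := MM_upper _ hfx
  have h3 : MM ⌊x⌋₊ = MM ⌊y⌋₊ + ∑ q ∈ (prs ⌊x⌋₊).filter (fun q : ℕ => y < q), Real.log q / q := by
    rw [MM, ← sum_filter_not_add_sum_filter (prs ⌊x⌋₊) (fun q : ℕ => y < q)]
    congr 1
    rw [MM]
    apply sum_congr _ (fun _ _ => rfl)
    ext q
    rw [mem_filter, mem_prs, mem_prs, not_lt, Nat.le_floor_iff (by linarith), Nat.le_floor_iff (by linarith)]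
    constructor
    · rintro ⟨⟨a, b⟩, c⟩; exact ⟨a, c⟩
    · rintro ⟨a, b⟩; exact ⟨⟨a, b.trans hxy⟩, b⟩
  have h4 : (∑ q ∈ (prs ⌊x⌋₊).filter (fun q : ℕ => y < q), (1:ℝ) / q) * Real.log y ≤ ∑ q ∈ (prs ⌊x⌋₊).filter (fun q : ℕ => y < q), Real.log q / q := by
    rw [sum_mul]
    apply sum_le_sum
    intro q hq
    rw [mem_filter] at hq
    rw [div_mul_eq_mul_div, one_mul]
    have : Real.log y ≤ Real.log q := Real.log_le_log (by linarith) hq.2.le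
    gcongr
  have h5 : Real.log ⌊x⌋₊ ≤ Real.log x := Real.log_le_log (by exact_mod_cast hfx) (Nat.floor_le (by linarith))
  have h6 : Real.log y ≤ Real.log 2 + Real.log ⌊y⌋₊ := by
    have h0 : (1:ℝ) ≤ ⌊y⌋₊ := by exact_mod_cast hfy
    rw [← Real.log_mul (by norm_num) (by linarith)]
    apply Real.log_le_log (by linarith)
    have := Nat.lt_floor_add_one y
    linarith
  linarith

/-- primes in a real interval -/
noncomputable def RR (y x : ℝ) : ℝ := ∑ q ∈ (prs ⌊x⌋₊).filter (fun q : ℕ => y < q), (1:ℝ) / q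

lemma RR_mono (y x x' : ℝ) (h : x ≤ x') : RR y x ≤ RR y x' := by
  apply sum_le_sum_of_subset_of_nonneg
  · intro q hq
    rw [mem_filter, mem_prs] at hq ⊢
    exact ⟨⟨hq.1.1, hq.1.2.trans (Nat.floor_mono h)⟩, hq.2⟩
  · intros; positivity

lemma RR_add (y z x : ℝ) : RR y x ≤ RR y z + RR z x := by
  unfold RR
  rw [← sum_filter_add_sum_filter_not ((prs ⌊x⌋₊).filter (fun q : ℕ => y < q)) (fun q : ℕ => q ≤ z)]
  apply add_le_add
  · apply sum_le_sum_of_subset_of_nonneg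
    · intro q hq
      simp only [mem_filter, mem_prs] at hq ⊢
      exact ⟨⟨hq.1.1.1, Nat.le_floor hq.2⟩, hq.1.2⟩
    · intros; positivity
  · apply sum_le_sum_of_subset_of_nonneg
    · intro q hq
      simp only [mem_filter, mem_prs] at hq ⊢
      exact ⟨hq.1.1, not_le.mp hq.2⟩
    · intros; positivity

lemma mertens2 (ρ μ : ℝ) (hρ : 1 < ρ) (hμ : Real.log ρ < μ) :
    ∃ Y : ℝ, 1 < Y ∧ ∀ y x : ℝ, Y ≤ y → Real.log x ≤ ρ * Real.log y → 0 < x → RR y x ≤ μ := by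
  obtain ⟨C, hC, hM⟩ := mertens_int
  have hl : 0 < Real.log ρ := Real.log_pos hρ
  set L := Real.log ρ with hL
  obtain ⟨K, hK⟩ := exists_nat_gt (max (max L 1) (L ^ 2 / (μ - L)))
  have hK1 : L < K := lt_of_le_of_lt ((le_max_left _ _).trans (le_max_left _ _)) hK
  have hK2 : (1:ℝ) < K := lt_of_le_of_lt ((le_max_right _ _).trans (le_max_left _ _)) hK
  have hK3 : L ^ 2 / (μ - L) < K := lt_of_le_of_lt (le_max_right _ _) hK
  have hK0 : (0:ℝ) < K := by linarith
  set l : ℝ := Real.exp (L / K) with hl'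
  have hl1 : 1 < l := by rw [hl']; exact Real.one_lt_exp_iff.mpr (by positivity)
  have hlK : l ^ K = ρ := by
    rw [hl', ← Real.exp_nat_mul, mul_div_cancel₀ _ hK0.ne', hL, Real.exp_log (by linarith)]
  have hKl : K * (l - 1) < μ := by
    have h1 : |L / K| ≤ 1 := by
      rw [abs_of_pos (by positivity), div_le_one hK0]; exact hK1.le
    have h2 := (abs_le.mp (Real.abs_exp_sub_one_sub_id_le h1)).2
    have h3 : K * (l - 1) ≤ K * (L / K + (L/K)^2) := by
      apply mul_le_mul_of_nonneg_left _ hK0.le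
      rw [hl']; linarith
    have h4 : K * (L / K + (L/K)^2) = L + L^2 / K := by field_simp
    have h5 : L^2 / K < μ - L := by
      rw [div_lt_iff₀ hK0]
      rw [div_lt_iff₀ (by linarith)] at hK3
      linarith
    linarith
  set d := μ - K * (l - 1) with hd
  have hd0 : 0 < d := by rw [hd]; linarith
  refine ⟨Real.exp (K * C / d + 1), Real.one_lt_exp_iff.mpr (by positivity), fun y x hy hx hx0 => ?_⟩
  have hy0 : 0 < y := lt_of_lt_of_le (Real.exp_pos _) hy
  have hly : K * C / d + 1 ≤ Real.log y := by
    rw [Real.le_log_iff_exp_le hy0]; exact hy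
  have hly1 : 1 ≤ Real.log y := by
    have : 0 ≤ K * C / d := by positivity
    linarith
  have hblock : ∀ i : ℕ, RR y (Real.exp (l ^ i * Real.log y)) ≤ i * ((l - 1) + C / Real.log y) := by
    intro i
    induction i with
    | zero =>
      rw [pow_zero, one_mul, Real.exp_log hy0]
      unfold RR
      rw [filter_eq_empty_iff.mpr]
      · simp
      · intro q hq
        rw [mem_prs] at hq
        have := (Nat.le_floor_iff hy0.le).mp hq.2
        linarith
    | succ i ih =>
      have hli : 1 ≤ l ^ i := one_le_pow₀ hl1.le
      have hb := hM (Real.exp (l ^ (i+1) * Real.log y)) (Real.exp (l ^ i * Real.log y))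
        (Real.one_lt_exp_iff.mpr (by positivity)) (by
          apply Real.exp_le_exp.mpr
          apply mul_le_mul_of_nonneg_right _ (by linarith)
          exact pow_le_pow_right₀ hl1.le (by omega))
      rw [Real.log_exp, Real.log_exp] at hb
      have e : (l ^ (i+1) * Real.log y - l ^ i * Real.log y + C) / (l ^ i * Real.log y) = (l - 1) + C / (l ^ i * Real.log y) := by
        have : l ^ i * Real.log y ≠ 0 := by positivity
        rw [div_eq_iff this, add_mul, div_mul_cancel₀ _ this]
        ring
      rw [e] at hb
      have e2 : C / (l ^ i * Real.log y) ≤ C / Real.log y := by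
        apply div_le_div_of_nonneg_left hC (by linarith)
        nlinarith
      have e3 := RR_add y (Real.exp (l ^ i * Real.log y)) (Real.exp (l ^ (i+1) * Real.log y))
      have e4 : RR (Real.exp (l ^ i * Real.log y)) (Real.exp (l ^ (i+1) * Real.log y)) ≤ (l - 1) + C / Real.log y :=
        hb.trans (by linarith)
      push_cast
      linarith
  have h1 := hblock K
  rw [hlK] at h1
  have h2 : x ≤ Real.exp (ρ * Real.log y) := by
    rw [← Real.log_le_iff_le_exp hx0]; exact hx
  refine (RR_mono y _ _ h2).trans (h1.trans ?_)
  have h3 : K * (C / Real.log y) ≤ d := by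
    rw [← mul_div_assoc, div_le_iff₀ (by linarith), mul_comm d, ← div_le_iff₀ hd0]
    linarith
  linarith

end Stp
end

section
namespace Stp
variable {p : ℕ} [Fact p.Prime]
open Finset

lemma nat_cast_ne (n : ℕ) (h0 : 1 ≤ n) (h1 : n < p) : (n : ZMod p) ≠ 0 := by
  rw [Ne, ZMod.natCast_eq_zero_iff]
  intro h
  have := Nat.le_of_dvd (by omega) h
  omega

lemma chi_sq_one (x : ZMod p) (hx : x ≠ 0) : chi p x * chi p x = 1 := by
  have h := quadraticChar_sq_one hx
  rw [chi, ← pow_two]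
  exact_mod_cast h

lemma chi_isSquare (x : ZMod p) (hx : x ≠ 0) (h : IsSquare x) : chi p x = 1 := by
  have := (quadraticChar_one_iff_isSquare hx).mpr h
  rw [chi, this]; simp

lemma isSquare_of_factors (n : ℕ) (hn : n ≠ 0) (h : ∀ q : ℕ, q.Prime → q ∣ n → IsSquare (q : ZMod p)) : IsSquare (n : ZMod p) := by
  induction n using Nat.recOnMul with
  | zero => omega
  | one => simp
  | prime q hq => exact h q hq dvd_rfl
  | mul a b ha hb =>
    rw [Nat.cast_mul]
    have h1 : a ≠ 0 := by rintro rfl; simp at hn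
    have h2 : b ≠ 0 := by rintro rfl; simp at hn
    exact (ha h1 (fun q hq hd => h q hq (hd.mul_right _))).mul (hb h2 (fun q hq hd => h q hq (hd.mul_left _)))

lemma vino (N : ℕ) (hN : N < p) (y : ℝ) (hy : ∀ n : ℕ, 0 < n → (n:ℝ) ≤ y → IsSquare (n : ZMod p)) :
    (N:ℝ) - 2 * N * RR y N ≤ ∑ b ∈ Icc 1 N, chi p (b : ZMod p) := by
  classical
  set Q := (prs N).filter (fun q : ℕ => y < q) with hQ
  have h1 : ∀ b ∈ Icc 1 N, 1 - 2 * ∑ q ∈ Q, (if q ∣ b then (1:ℝ) else 0) ≤ chi p (b : ZMod p) := by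
    intro b hb
    rw [mem_Icc] at hb
    have hb0 := nat_cast_ne (p := p) b hb.1 (by omega)
    by_cases hs : IsSquare (b : ZMod p)
    · rw [chi_isSquare _ hb0 hs]
      have : 0 ≤ ∑ q ∈ Q, (if q ∣ b then (1:ℝ) else 0) := sum_nonneg (fun q _ => by split_ifs <;> norm_num)
      linarith
    · have hex : ∃ q : ℕ, q.Prime ∧ q ∣ b ∧ ¬ IsSquare (q : ZMod p) := by
        by_contra hcon
        push Not at hcon
        exact hs (isSquare_of_factors b (by omega) hcon)
      obtain ⟨q, hq, hqb, hqs⟩ := hex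
      have hqQ : q ∈ Q := by
        rw [hQ, mem_filter, mem_prs]
        refine ⟨⟨hq, (Nat.le_of_dvd (by omega) hqb).trans hb.2⟩, ?_⟩
        by_contra hcon
        exact hqs (hy q hq.pos (not_lt.mp hcon))
      have h2 : (1:ℝ) ≤ ∑ q ∈ Q, (if q ∣ b then (1:ℝ) else 0) := by
        have := single_le_sum (f := fun q => if q ∣ b then (1:ℝ) else 0) (s := Q) (fun q _ => by split_ifs <;> norm_num) hqQ
        simpa [hqb] using this
      have h3 := (abs_le.mp (chi_abs_le (b : ZMod p))).1
      linarith
  have h2 := sum_le_sum h1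
  refine le_trans ?_ h2
  rw [sum_sub_distrib, ← mul_sum, sum_comm]
  have h3 : ∑ q ∈ Q, ∑ b ∈ Icc 1 N, (if q ∣ b then (1:ℝ) else 0) ≤ N * RR y N := by
    unfold RR
    rw [Nat.floor_natCast, mul_sum]
    apply sum_le_sum
    intro q _
    rw [sum_boole]
    have : (filter (fun b => q ∣ b) (Icc 1 N)).card = N / q := Nat.Ioc_filter_dvd_card_eq_div N q
    rw [this, mul_one_div]
    exact Nat.cast_div_le
  simp only [sum_const, Nat.card_Icc, Nat.add_sub_cancel, nsmul_eq_mul, mul_one]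
  linarith

lemma box_fail (hp2 : p ≠ 2) (c : ℤ) (hc : (c : ZMod p) ≠ 0) (H : ℕ)
    (hno : ¬ ∃ X Y : ℤ, ∃ x1 y1 x2 y2 : ZMod p,
          x1 * y1 = (c : ZMod p) ∧ x2 * y2 = (c : ZMod p) ∧ (x1, y1) ≠ (x2, y2) ∧
          InBox p X (H : ℤ) x1 ∧ InBox p Y (H : ℤ) y1 ∧
          InBox p X (H : ℤ) x2 ∧ InBox p Y (H : ℤ) y2) (a b : ℕ) (ha1 : 1 ≤ a) (hb1 : 1 ≤ b)
    (haH : a + 1 ≤ H) (hbH : b + 1 ≤ H) (ha : (a : ZMod p) ≠ 0) (hb : (b : ZMod p) ≠ 0) :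
    chi p ((b : ZMod p) - 4 * (c : ZMod p) * (a : ZMod p)⁻¹) = - chi p (b : ZMod p) := by
  have h2 : (2 : ZMod p) ≠ 0 := by
    have := nat_cast_ne (p := p) 2 (by norm_num) (by
      have := (Fact.out : p.Prime).two_le
      omega)
    simpa using this
  have hns : ¬ IsSquare ((a : ZMod p) * b * (a * b - 4 * c)) := by
    rintro ⟨s, hs⟩
    apply hno
    set x : ZMod p := (s - a * b) * (2 * (b : ZMod p))⁻¹ with hx
    have hxe : 2 * b * x = s - a * b := by rw [hx]; field_simp
    have heq : (b : ZMod p) * x ^ 2 + a * b * x + a * c = 0 := by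
      have : 4 * (b:ZMod p) * (b * x ^ 2 + a * b * x + a * c) = 0 := by
        have e : 4 * (b:ZMod p) * (b * x ^ 2 + a * b * x + a * c) = (2 * b * x) ^ 2 + 2 * (a * b) * (2 * b * x) + 4 * a * b * c := by ring
        rw [e, hxe]
        linear_combination -hs
      have h4 : (4 : ZMod p) ≠ 0 := by
        rw [show (4 : ZMod p) = 2 * 2 by norm_num]; exact mul_ne_zero h2 h2
      exact (mul_eq_zero.mp this).resolve_left (mul_ne_zero h4 hb)
    have hx0 : x ≠ 0 := by
      intro h
      rw [h] at heq
      have : (a : ZMod p) * c = 0 := by linear_combination heq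
      exact mul_ne_zero ha hc this
    set y : ZMod p := c * x⁻¹ with hy
    have hxy : x * y = c := by rw [hy]; field_simp
    have key : (b : ZMod p) * x + a * y + a * b = 0 := by
      have : x * ((b : ZMod p) * x + a * y + a * b) = 0 := by
        linear_combination heq + a * hxy
      exact (mul_eq_zero.mp this).resolve_left hx0
    refine ⟨(x.val : ℤ) - 1, (y.val : ℤ) - 1, x, y, x + a, y + b, hxy, ?_, ?_, ?_, ?_, ?_, ?_⟩
    · linear_combination hxy + key
    · intro h
      have := (Prod.mk.inj h).1
      exact ha (by linear_combination -this)
    · exact ⟨x.val, by omega, by omega, by simp⟩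
    · exact ⟨y.val, by omega, by omega, by simp⟩
    · exact ⟨x.val + a, by omega, by omega, by simp⟩
    · exact ⟨y.val + b, by omega, by omega, by simp⟩
  have h3 : chi p ((a : ZMod p) * b * (a * b - 4 * c)) = -1 := by
    have := quadraticChar_neg_one_iff_not_isSquare.mpr hns
    rw [chi, this]; simp
  have e : (a : ZMod p) * b * (a * b - 4 * c) = a * a * (b * (b - 4 * c * (a : ZMod p)⁻¹)) := by
    field_simp
  rw [e, chi_mul, chi_mul, chi_mul, chi_sq_one _ ha] at h3
  have h4 := chi_sq_one _ hb
  linear_combination (chi p (b : ZMod p)) * h3 - (chi p ((b : ZMod p) - 4 * (c : ZMod p) * (a : ZMod p)⁻¹)) * h4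

end Stp
end

section
namespace Stp
open Finset Filter

lemma deduct (A N U V δ Dv P M1 M2 : ℝ) (n : ℕ) (hA : 0 < A) (hN : 0 < N) (hU : 0 < U) (hV : 0 < V) (hP : 0 < P)
    (hM1 : 0 ≤ M1) (hVP : √P ≤ V ^ (n+1))
    (h : (A * U * V * (δ * N)) ^ (2 * (n+1)) ≤ (A * N * U) ^ (2 * n) *
      (10 * (N ^ 2 * U * Dv ^ 2) * (M1 * V ^ (n+1) * P + M2 * V ^ (2 * (n+1)) * √P))) :
    A ^ 2 * U * δ ^ (2 * (n+1)) ≤ 10 * (M1 + M2) * Dv ^ 2 * √P := by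
  have h1 : V ^ (n+1) * P ≤ V ^ (2 * (n+1)) * √P := by
    have e : V ^ (2 * (n+1)) = V ^ (n+1) * V ^ (n+1) := by ring
    have e2 : P = √P * √P := (Real.mul_self_sqrt hP.le).symm
    calc V ^ (n+1) * P = V ^ (n+1) * (√P * √P) := by rw [← e2]
      _ ≤ V ^ (n+1) * (V ^ (n+1) * √P) := by gcongr
      _ = _ := by rw [e]; ring
  have h2 : M1 * V ^ (n+1) * P + M2 * V ^ (2 * (n+1)) * √P ≤ (M1 + M2) * (V ^ (2 * (n+1)) * √P) := by
    have := mul_le_mul_of_nonneg_left h1 hM1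
    linarith
  have h3 := h.trans (mul_le_mul_of_nonneg_left (mul_le_mul_of_nonneg_left h2 (by positivity)) (by positivity))
  have hpos : 0 < (A * N * U) ^ (2 * n) * (N ^ 2 * U * V ^ (2 * (n+1))) := by positivity
  refine le_of_mul_le_mul_left ?_ hpos
  calc _ = (A * U * V * (δ * N)) ^ (2 * (n+1)) := by ring
    _ ≤ _ := h3
    _ = _ := by ring

lemma pi_lower (N : ℕ) (hN : 4 ≤ N) : (N:ℝ) / (4 * Real.log N) ≤ (prs N).card := by
  have hN' : (4:ℝ) ≤ N := by exact_mod_cast hN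
  have h1 := Chebyshev.psi_ge N
  have h2 := Chebyshev.psi_le_primeCounting_mul_log N
  have hc : (prs N).card = Nat.primeCounting N := by
    rw [Nat.primeCounting, Nat.primeCounting', Nat.count_eq_card_filter_range]
    congr 1
    ext q
    rw [mem_prs, mem_filter, mem_range]
    constructor
    · rintro ⟨a, b⟩; exact ⟨by omega, a⟩
    · rintro ⟨a, b⟩; exact ⟨b, by omega⟩
  have hl : 0 < Real.log N := Real.log_pos (by linarith)
  have h3 : Real.log ((N:ℝ) + 1) ≤ 3 * Real.log 2 + ((N:ℝ)+1) / 8 - 1 := by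
    have := Real.log_le_sub_one_of_pos (x := ((N:ℝ)+1)/8) (by positivity)
    rw [Real.log_div (by positivity) (by norm_num), show (8:ℝ) = 2 ^ 3 by norm_num, Real.log_pow] at this
    push_cast at this
    linarith
  have h4 := Real.log_two_gt_d9
  have h5 := Real.log_two_lt_d9
  rw [hc, div_le_iff₀ (by positivity)]
  nlinarith

end Stp
end

section
namespace Stp
open Finset Filter

lemma alg1 (N Z δ d : ℝ) (hZ : 0 < Z) : (N / Z) ^ 2 * (δ * N / (8 * Z ^ 8)) * d = N ^ 3 * (d * δ) / (8 * Z ^ 10) := by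
  field_simp

lemma alg2 (q Z d : ℝ) (hZ : 0 < Z) : (q * Z ^ 24 / 8) * d / (8 * Z ^ 10) = q * Z ^ 2 * (Z ^ 12 * d) / 64 := by
  field_simp
  ring

set_option maxHeartbeats 1000000 in
lemma core {p : ℕ} [Fact p.Prime] (hp2 : p ≠ 2) (k : ZMod p) (hk : k ≠ 0) (n : ℕ) (Z W δ C S M : ℝ)
    (hδ : 0 < δ) (hδ1 : δ ≤ 1) (hC : 1 ≤ C) (hZ1 : 1 ≤ Z) (hZP : √(p:ℝ) = Z ^ (8 * (n+1))) (hWP : √(p:ℝ) * Z ^ 24 ≤ W ^ 3)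
    (hD : ∀ m : ℕ, m ≠ 0 → m < p → (m.divisors.card : ℝ) ≤ C * Z)
    (hM : M = ((n+1 : ℕ):ℝ) ^ (2*(n+1)) + 100 * (n+1 : ℕ))
    (E2 : 8 * Z ^ 8 ≤ δ * W) (E3 : 2 * W ^ 4 < p) (E4 : 2 * Z ^ 8 < p) (E5 : 8 * Real.log p ≤ Z) (E5' : 4 ≤ W)
    (E6 : 2560 * M * C ^ 2 < Z ^ 12 * δ ^ (2 * (n+1) + 1))
    (hSl : 2 * δ * ⌊W⌋₊ ≤ S)
    (hS : ∀ a : ℕ, 1 ≤ a → a ≤ ⌊W⌋₊ → ∑ b ∈ Finset.Icc 1 ⌊W⌋₊, chi p ((b : ZMod p) - k * (a : ZMod p)⁻¹) = - S) : False := by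
  classical
  have hp0 : (0:ℝ) < p := by exact_mod_cast (Fact.out : p.Prime).pos
  have hZ0 : 0 < Z := by linarith
  have hZ8 : 1 ≤ Z ^ 8 := one_le_pow₀ hZ1
  set N := ⌊W⌋₊ with hNd
  have hN4 : 4 ≤ N := Nat.le_floor (by exact_mod_cast E5')
  have hN4' : (4:ℝ) ≤ N := by exact_mod_cast hN4
  have hNW : (N:ℝ) ≤ W := Nat.floor_le (by linarith)
  have hNW2 : W / 2 ≤ N := by
    have := Nat.lt_floor_add_one W
    rw [← hNd] at this
    linarith
  have hN0 : (0:ℝ) < N := by linarith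
  set V := ⌈Z ^ 8⌉₊ with hVd
  have hV1 : Z ^ 8 ≤ V := Nat.le_ceil _
  have hV2 : (V:ℝ) ≤ 2 * Z ^ 8 := by
    have := Nat.ceil_lt_add_one (a := Z ^ 8) (by positivity)
    rw [← hVd] at this
    linarith
  have hV0 : (0:ℝ) < V := by linarith
  set u : ℝ := δ * N / (2 * V) with hu
  set U := ⌊u⌋₊ with hUd
  have hu1 : 1 ≤ u := by
    rw [hu, le_div_iff₀ (by positivity)]
    nlinarith
  have hU1 : 1 ≤ U := Nat.le_floor (by exact_mod_cast hu1)
  have hUu : (U:ℝ) ≤ u := Nat.floor_le (by linarith)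
  have hU2 : u / 2 ≤ U := by
    have := Nat.lt_floor_add_one u
    rw [← hUd] at this
    have : (1:ℝ) ≤ U := by exact_mod_cast hU1
    linarith
  have hU0 : (0:ℝ) < U := by exact_mod_cast hU1
  have huN : u ≤ N / Z := by
    rw [hu, div_le_div_iff₀ (by positivity) hZ0]
    have h1 : Z ≤ Z ^ 8 := le_self_pow₀ hZ1 (by norm_num)
    have h2 : δ * N ≤ N := by nlinarith
    have h3 : Z ≤ 2 * V := by linarith
    exact mul_le_mul h2 h3 hZ0.le hN0.le
  have hUNr : (U:ℝ) ≤ N := by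
    have : (N:ℝ) / Z ≤ N := div_le_self hN0.le hZ1
    linarith
  have hUN : U ≤ N := by exact_mod_cast hUNr
  have hUl : δ * N / (8 * Z ^ 8) ≤ U := by
    refine le_trans ?_ hU2
    rw [hu, div_div]
    apply div_le_div_of_nonneg_left (by positivity) (by positivity)
    linarith
  have hVp : V < p := by
    have : (V:ℝ) < p := by linarith
    exact_mod_cast this
  have hsz : 2 * (N ^ 3 * U) < p := by
    have h1 : N ^ 3 * U ≤ N ^ 4 := by
      rw [pow_succ N 3]; exact Nat.mul_le_mul_left _ hUN
    have h2 : ((2 * N ^ 4 : ℕ):ℝ) < p := by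
      push_cast
      refine lt_of_le_of_lt ?_ E3
      gcongr
    have h3 : 2 * N ^ 4 < p := by exact_mod_cast h2
    omega
  have hNp : N < p := by
    have h1 : N ^ 1 * 1 ≤ N ^ 3 * U := Nat.mul_le_mul (Nat.pow_le_pow_right (by omega) (by norm_num)) hU1
    rw [pow_one, mul_one] at h1
    omega
  set Dv := ⌈C * Z⌉₊ with hDv
  have hCZ : 1 ≤ C * Z := by nlinarith
  have hDv1 : 1 ≤ Dv := Nat.one_le_ceil_iff.mpr (by linarith)
  have hDv2 : (Dv:ℝ) ≤ 2 * (C * Z) := by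
    have := Nat.ceil_lt_add_one (a := C * Z) (by linarith)
    rw [← hDv] at this
    linarith
  have hDD : ∀ m : ℕ, m < p → m.divisors.card ≤ Dv := by
    intro m hm
    rcases Nat.eq_zero_or_pos m with h | h
    · subst h; simp
    · have := (hD m (by omega) hm).trans (Nat.le_ceil (C * Z))
      exact_mod_cast this
  set A := (prs N).filter (fun a => U < a) with hA
  have hAm : ∀ a ∈ A, a.Prime ∧ U < a ∧ a ≤ N := by
    intro a ha
    rw [hA, mem_filter, mem_prs] at ha
    exact ⟨ha.1.1, ha.2, ha.1.2⟩
  have hAc : (N:ℝ) / Z ≤ A.card := by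
    have h1 := pi_lower N hN4
    have h2 : (prs N).card ≤ A.card + U := by
      rw [← card_filter_add_card_filter_not (s := prs N) (fun a => U < a)]
      apply Nat.add_le_add_left
      calc _ ≤ (Icc 1 U).card := card_le_card (fun a ha => by
            rw [mem_filter, mem_prs] at ha
            rw [mem_Icc]
            exact ⟨ha.1.1.one_lt.le, by omega⟩)
        _ = U := by simp
    have h2' : ((prs N).card : ℝ) ≤ A.card + U := by exact_mod_cast h2
    have h3 : Real.log N ≤ Real.log p := Real.log_le_log hN0 (by exact_mod_cast hNp.le)
    have hl : 0 < Real.log N := Real.log_pos (by linarith)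
    have h4 : 2 * (N:ℝ) / Z ≤ N / (4 * Real.log N) := by
      rw [div_le_div_iff₀ hZ0 (by positivity)]
      nlinarith
    have h5 : 2 * (N:ℝ) / Z = N / Z + N / Z := by ring
    linarith
  have hA0 : (0:ℝ) < A.card := lt_of_lt_of_le (by positivity) hAc
  have hUV : 2 * ((U:ℝ) * V) ≤ δ * N := by
    have : (U:ℝ) * V ≤ u * V := by gcongr
    have h2 : u * V = δ * N / 2 := by rw [hu]; field_simp
    linarith
  have hb := burgess hp2 k hk N U V Dv n hU1 hUN hDv1 hVp hsz hDD A hAm S (δ * N) (by positivity) (by linarith)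
    (fun a ha => hS a (hAm a ha).1.one_lt.le (hAm a ha).2.2)
  have hd := deduct A.card N U V δ Dv p _ _ n hA0 hN0 hU0 hV0 hp0 (by positivity) (by
    rw [hZP, pow_mul]; gcongr) hb
  rw [← hM] at hd
  have hM0 : 0 ≤ M := by rw [hM]; positivity
  have hsq : 0 < √(p:ℝ) := Real.sqrt_pos.mpr hp0
  have h1 : 10 * M * (Dv:ℝ) ^ 2 * √(p:ℝ) ≤ 10 * M * (2 * (C * Z)) ^ 2 * √(p:ℝ) := by gcongr
  have h2 : ((N:ℝ) / Z) ^ 2 * (δ * N / (8 * Z ^ 8)) * δ ^ (2 * (n+1)) ≤ (A.card : ℝ) ^ 2 * U * δ ^ (2 * (n+1)) := by gcongr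
  have h3 : ((N:ℝ) / Z) ^ 2 * (δ * N / (8 * Z ^ 8)) * δ ^ (2 * (n+1)) = (N:ℝ) ^ 3 * δ ^ (2 * (n+1) + 1) / (8 * Z ^ 10) := by
    rw [alg1 _ _ _ _ hZ0, ← pow_succ]
  have h4 : √(p:ℝ) * Z ^ 24 / 8 ≤ (N:ℝ) ^ 3 := by
    have : (W / 2) ^ 3 ≤ (N:ℝ) ^ 3 := by gcongr
    have e : (W/2) ^ 3 = W ^ 3 / 8 := by ring
    linarith
  have h5 : (√(p:ℝ) * Z ^ 24 / 8) * δ ^ (2 * (n+1) + 1) / (8 * Z ^ 10) ≤ (N:ℝ) ^ 3 * δ ^ (2 * (n+1) + 1) / (8 * Z ^ 10) := by gcongr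
  have h6 : (√(p:ℝ) * Z ^ 24 / 8) * δ ^ (2 * (n+1) + 1) / (8 * Z ^ 10) = √(p:ℝ) * Z ^ 2 * (Z ^ 12 * δ ^ (2 * (n+1) + 1)) / 64 := alg2 _ _ _ hZ0
  have h7 : √(p:ℝ) * Z ^ 2 * (2560 * M * C ^ 2) < √(p:ℝ) * Z ^ 2 * (Z ^ 12 * δ ^ (2 * (n+1) + 1)) := by
    apply mul_lt_mul_of_pos_left E6; positivity
  have h8 : 10 * M * (2 * (C * Z)) ^ 2 * √(p:ℝ) = √(p:ℝ) * Z ^ 2 * (2560 * M * C ^ 2) / 64 := by ring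
  linarith

set_option maxHeartbeats 1000000 in
lemma main_large (ε : ℝ) (hε : 0 < ε) (hε1 : ε ≤ 1 / 100) : ∃ p0 : ℕ, ∀ p : ℕ, p0 ≤ p → p.Prime → p ≠ 2 →
    (∀ m : ℕ, 0 < m → (m:ℝ) ≤ (p:ℝ) ^ (1 / (6 * √(Real.exp 1)) + ε) → IsSquare (m : ZMod p)) →
    ∀ c : ℤ, (c : ZMod p) ≠ 0 → ∀ H : ℕ, (p:ℝ) ^ ((1:ℝ)/6 + ε) + 1 ≤ H → H < p →
    ∃ X Y : ℤ, ∃ x1 y1 x2 y2 : ZMod p,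
          x1 * y1 = (c : ZMod p) ∧ x2 * y2 = (c : ZMod p) ∧ (x1, y1) ≠ (x2, y2) ∧
          InBox p X (H : ℤ) x1 ∧ InBox p Y (H : ℤ) y1 ∧
          InBox p X (H : ℤ) x2 ∧ InBox p Y (H : ℤ) y2 := by
  set s := √(Real.exp 1) with hs
  have hs1 : 1 < s := by
    rw [hs, Real.lt_sqrt (by norm_num)]
    have := Real.add_one_lt_exp (x := 1) (by norm_num)
    linarith
  have hlogs : Real.log s = 1 / 2 := by rw [hs, Real.log_sqrt (Real.exp_pos _).le, Real.log_exp]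
  set α : ℝ := 1/6 + ε with hα
  set β : ℝ := 1 / (6 * s) + ε with hβ
  have hβ0 : 0 < β := by positivity
  have hsβ : s * β = 1/6 + s * ε := by rw [hβ]; field_simp
  have hβα : β < α := by
    rw [hα, hβ]
    have : 1 / (6 * s) < 1 / 6 := by
      apply div_lt_div_of_pos_left (by norm_num) (by norm_num); linarith
    linarith
  set ρ := α / β with hρ
  have hρ1 : 1 < ρ := by rw [hρ, lt_div_iff₀ hβ0]; linarith
  have hρs : ρ < s := by rw [hρ, div_lt_iff₀ hβ0, hsβ, hα]; nlinarith
  have hlρ : Real.log ρ < 1 / 2 := by rw [← hlogs]; exact Real.log_lt_log (by linarith) hρs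
  have hlρ0 : 0 < Real.log ρ := Real.log_pos hρ1
  set μ := (Real.log ρ + 1/2) / 2 with hμ
  obtain ⟨Y, hY1, hmer⟩ := mertens2 ρ μ hρ1 (by rw [hμ]; linarith)
  set δ := 1/2 - μ with hδ
  have hδ0 : 0 < δ := by rw [hδ, hμ]; linarith
  have hδ1 : δ ≤ 1 := by rw [hδ, hμ]; linarith
  obtain ⟨n, hn⟩ := exists_nat_gt (1 / (2 * ε))
  set κ : ℝ := 1 / (16 * ((n:ℝ) + 1)) with hκ
  have hκ0 : 0 < κ := by positivity
  have hκε : 8 * κ ≤ ε := by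
    rw [div_lt_iff₀ (by positivity)] at hn
    rw [hκ, mul_one_div, div_le_iff₀ (by positivity)]
    nlinarith
  obtain ⟨C, hC1, hC⟩ := divisor_bound κ hκ0
  set M : ℝ := ((n+1 : ℕ):ℝ) ^ (2*(n+1)) + 100 * (n+1 : ℕ) with hM
  -- eventual conditions
  have T : ∀ e : ℝ, 0 < e → ∀ K : ℝ, ∀ᶠ P : ℝ in atTop, K < P ^ e := fun e he K =>
    (tendsto_rpow_atTop he).eventually_gt_atTop K
  have hT : Tendsto (fun p : ℕ => (p:ℝ)) atTop atTop := tendsto_natCast_atTop_atTop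
  have EL : ∀ᶠ P : ℝ in atTop, 8 * Real.log P ≤ P ^ κ := by
    have := (isLittleO_log_rpow_atTop hκ0).bound (c := 1/8) (by norm_num)
    filter_upwards [this, eventually_ge_atTop 1] with P hP hP1
    rw [Real.norm_eq_abs, Real.norm_eq_abs, abs_of_nonneg (Real.log_nonneg hP1), abs_of_nonneg (by positivity)] at hP
    linarith
  have Eall := hT.eventually ((T β hβ0 Y).and ((T (α - 8 * κ) (by rw [hα]; linarith) (8 / δ)).and
    ((T (1 - 4 * α) (by rw [hα]; linarith) 2).and ((T (1 - 8 * κ) (by linarith) 2).and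
    (EL.and ((T α (by positivity) 4).and ((T (12 * κ) (by positivity) (2560 * M * C ^ 2 / δ ^ (2 * (n+1) + 1))).and
    (eventually_ge_atTop (1:ℝ)))))))))
  obtain ⟨p0, hp0⟩ := eventually_atTop.mp Eall
  refine ⟨p0, fun p hp hprime hp2 hsq c hc H hH1 hH2 => ?_⟩
  obtain ⟨e1, e2, e3, e4, e5, e6, e7, e8⟩ := hp0 p hp
  have := Fact.mk hprime
  by_contra hno
  have hP0 : (0:ℝ) < p := by linarith
  set P : ℝ := (p:ℝ) with hP
  set Z := P ^ κ with hZ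
  set W := P ^ α with hW
  have hZpow : ∀ i : ℕ, Z ^ i = P ^ (κ * i) := fun i => by
    rw [hZ, ← Real.rpow_natCast, ← Real.rpow_mul hP0.le]
  have hWpow : ∀ i : ℕ, W ^ i = P ^ (α * i) := fun i => by
    rw [hW, ← Real.rpow_natCast, ← Real.rpow_mul hP0.le]
  have hN1 : ⌊W⌋₊ + 1 ≤ H := by
    have : (⌊W⌋₊ : ℝ) ≤ W := Nat.floor_le (by positivity)
    have : ((⌊W⌋₊ + 1 : ℕ) : ℝ) ≤ H := by push_cast; linarith
    exact_mod_cast this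
  have h4c : (4:ZMod p) * c ≠ 0 := by
    apply mul_ne_zero _ hc
    have h2 : (2 : ZMod p) ≠ 0 := by
      have := nat_cast_ne (p := p) 2 (by norm_num) (by
        have := hprime.two_le
        omega)
      simpa using this
    rw [show (4 : ZMod p) = 2 * 2 by norm_num]; exact mul_ne_zero h2 h2
  have hvino := vino (p := p) ⌊W⌋₊ (by omega) (P ^ β) hsq
  have hN4 : 4 ≤ ⌊W⌋₊ := Nat.le_floor (by exact_mod_cast e6.le)
  have hN0 : (0:ℝ) < ⌊W⌋₊ := by
    have : 0 < ⌊W⌋₊ := by omega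
    exact_mod_cast this
  have hRR : RR (P ^ β) (⌊W⌋₊ : ℝ) ≤ μ := by
    apply hmer _ _ e1.le _ hN0
    calc Real.log (⌊W⌋₊ : ℝ) ≤ Real.log W := Real.log_le_log hN0 (Nat.floor_le (by positivity))
      _ = ρ * Real.log (P ^ β) := by
        rw [hW, Real.log_rpow hP0, Real.log_rpow hP0, hρ]; field_simp
  refine core (p := p) hp2 (4 * (c : ZMod p)) h4c n Z W δ C (∑ b ∈ Icc 1 ⌊W⌋₊, chi p (b : ZMod p)) M hδ0 hδ1 hC1
    (Real.one_le_rpow e8 hκ0.le) ?_ ?_ ?_ hM ?_ ?_ ?_ e5 e6.le ?_ ?_ ?_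
  · rw [hZpow, Real.sqrt_eq_rpow]
    congr 1
    rw [hκ]; push_cast; field_simp; norm_num
  · rw [hZpow, hWpow, Real.sqrt_eq_rpow, ← Real.rpow_add hP0]
    apply Real.rpow_le_rpow_of_exponent_le e8
    rw [hα]; push_cast; linarith
  · intro m hm0 hm
    refine (hC m hm0).trans ?_
    have : (m:ℝ) ≤ P := by rw [hP]; exact_mod_cast hm.le
    rw [hZ]
    gcongr
  · rw [hZpow]
    rw [Real.rpow_sub hP0, div_lt_div_iff₀ hδ0 (by positivity)] at e2
    have : κ * (8:ℕ) = 8 * κ := by push_cast; ring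
    rw [this]; linarith
  · rw [hWpow]
    rw [Real.rpow_sub hP0, lt_div_iff₀ (by positivity), Real.rpow_one] at e3
    have : α * (4:ℕ) = 4 * α := by push_cast; ring
    rw [this]; linarith
  · rw [hZpow]
    rw [Real.rpow_sub hP0, lt_div_iff₀ (by positivity), Real.rpow_one] at e4
    have : κ * (8:ℕ) = 8 * κ := by push_cast; ring
    rw [this]; linarith
  · rw [hZpow]
    rw [div_lt_iff₀ (by positivity)] at e7
    have : κ * (12:ℕ) = 12 * κ := by push_cast; ring
    rw [this]; exact e7
  · refine le_trans ?_ hvino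
    have := mul_le_mul_of_nonneg_left hRR hN0.le
    rw [hδ]; linarith
  · intro a ha1 haN
    rw [← sum_neg_distrib]
    apply sum_congr rfl
    intro b hb
    rw [mem_Icc] at hb
    exact box_fail hp2 c hc H hno a b ha1 hb.1 (by omega) (by omega) (nat_cast_ne a ha1 (by omega)) (nat_cast_ne b hb.1 (by omega))

end Stp
end

/-- Theorem 2: for every `ε > 0` there is `C(ε)` such that for every odd prime `p`,
either the least quadratic nonresidue is at most `C(ε)·p^{1/(6√e)+ε}`, or for every
`c` coprime to `p` and every `C(ε)·p^{1/6+ε} ≤ H < p`, some box of side `H` contains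
two distinct points of the hyperbola `x*y ≡ c (mod p)`. -/
theorem stmt_12 : ∀ ε : ℝ, 0 < ε → ∃ C : ℝ, 0 < C ∧
    ∀ p : ℕ, p.Prime → Odd p →
    ((∃ n : ℕ, 0 < n ∧ ¬ IsSquare (n : ZMod p) ∧
        (n : ℝ) ≤ C * (p : ℝ) ^ (1 / (6 * Real.sqrt (Real.exp 1)) + ε)) ∨
      (∀ c : ℤ, IsCoprime c (p : ℤ) →
        ∀ H : ℕ, C * (p : ℝ) ^ ((1 : ℝ) / 6 + ε) ≤ (H : ℝ) → H < p →
        ∃ X Y : ℤ, ∃ x1 y1 x2 y2 : ZMod p,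
          x1 * y1 = (c : ZMod p) ∧ x2 * y2 = (c : ZMod p) ∧ (x1, y1) ≠ (x2, y2) ∧
          InBox p X (H : ℤ) x1 ∧ InBox p Y (H : ℤ) y1 ∧
          InBox p X (H : ℤ) x2 ∧ InBox p Y (H : ℤ) y2)) := by
  intro ε hε
  set ε' := min ε (1/100) with hε'
  have hε'0 : 0 < ε' := lt_min hε (by norm_num)
  have hle : ε' ≤ ε := min_le_left _ _
  obtain ⟨p0, hmain⟩ := Stp.main_large ε' hε'0 (min_le_right _ _)
  refine ⟨(p0:ℝ) + 2, by positivity, fun p hp hodd => ?_⟩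
  have hp1 : (1:ℝ) ≤ p := by exact_mod_cast hp.one_lt.le
  by_cases hlt : p < p0
  · right
    intro c _ H hH hHp
    exfalso
    have h1 : (1:ℝ) ≤ (p : ℝ) ^ ((1 : ℝ) / 6 + ε) := Real.one_le_rpow hp1 (by positivity)
    have h2 : (p0:ℝ) + 2 ≤ H := le_trans (by nlinarith [Nat.cast_nonneg (α := ℝ) p0]) hH
    have h3 : (H:ℝ) < p := by exact_mod_cast hHp
    have h4 : (p:ℝ) < p0 := by exact_mod_cast hlt
    linarith
  · rw [or_iff_not_imp_left]
    intro hno c hc H hH hHp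
    have hp2 : p ≠ 2 := by rintro rfl; revert hodd; decide
    refine hmain p (not_lt.mp hlt) hp hp2 ?_ c ?_ H ?_ hHp
    · intro m hm hmle
      by_contra hns
      apply hno
      refine ⟨m, hm, hns, hmle.trans ?_⟩
      have h1 : (p:ℝ) ^ (1 / (6 * Real.sqrt (Real.exp 1)) + ε') ≤ (p:ℝ) ^ (1 / (6 * Real.sqrt (Real.exp 1)) + ε) :=
        Real.rpow_le_rpow_of_exponent_le hp1 (by linarith)
      have h2 : 0 ≤ (p:ℝ) ^ (1 / (6 * Real.sqrt (Real.exp 1)) + ε) := by positivity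
      nlinarith [Nat.cast_nonneg (α := ℝ) p0]
    · rw [Ne, ZMod.intCast_zmod_eq_zero_iff_dvd]
      intro hd
      have hu := hc.isUnit_of_dvd' hd dvd_rfl
      have := Int.isUnit_iff.mp hu
      have := hp.one_lt
      omega
    · have h1 : (p:ℝ) ^ ((1:ℝ)/6 + ε') ≤ (p:ℝ) ^ ((1:ℝ)/6 + ε) :=
        Real.rpow_le_rpow_of_exponent_le hp1 (by linarith)
      have h2 : (1:ℝ) ≤ (p:ℝ) ^ ((1:ℝ)/6 + ε) := Real.one_le_rpow hp1 (by positivity)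
      nlinarith [Nat.cast_nonneg (α := ℝ) p0]
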